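/- Let n ≥ 3 and let 0 ≤ a < (n-2)/2, 0 < b, a ≤ b < a+1, p = 2n/(n-2+2(b-a)), ν > 0, α, β > 1 with α + β = p. Let (u, v) be a positive finite-energy solution of the Hénon–Sobolev system (S). Then there exist constants μ₀ > 0, c₁ > 0, c₂ > 0 such that u(x) = c₁ U_{μ₀}(x) and v(x) = c₂ U_{μ₀}(x) for all x ≠ 0, and moreover c₁^{p-2} + ν α c₁^{α-2} c₂^{β} = 1 and c₂^{p-2} + ν β c₁^{α} c₂^{β-2} = 1. -/

import Mathlib

open MeasureTheory Real Filter Topology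

noncomputable section

/-- Coordinate Laplacian on Euclidean space. -/
def lapl {n : ℕ} (w : EuclideanSpace ℝ (Fin n) → ℝ) (x : EuclideanSpace ℝ (Fin n)) : ℝ :=
  ∑ i : Fin n, fderiv ℝ (fun y => fderiv ℝ w y (EuclideanSpace.single i 1)) x
    (EuclideanSpace.single i 1)

/-- The weighted divergence `div(|x|^(-2a) ∇w)(x) = |x|^(-2a) (Δw(x) - 2a⟨x,∇w(x)⟩/|x|²)`. -/
def wdiv {n : ℕ} (a : ℝ) (w : EuclideanSpace ℝ (Fin n) → ℝ) (x : EuclideanSpace ℝ (Fin n)) : ℝ :=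
  ‖x‖ ^ (-(2*a)) * (lapl w x - 2*a * (@inner ℝ _ _ x (gradient w x)) / ‖x‖^2)

/-- Finiteness of the weighted Dirichlet energy `∫ |x|^(-2a) |∇w|² < ∞`. -/
def finiteEnergy {n : ℕ} (a : ℝ) (w : EuclideanSpace ℝ (Fin n) → ℝ) : Prop :=
  Integrable (fun x : EuclideanSpace ℝ (Fin n) => ‖x‖ ^ (-(2*a)) * ‖gradient w x‖^2)

/-- The standard bubble `U` of the critical Hénon equation. -/
def bubble (n : ℕ) (a b : ℝ) (x : EuclideanSpace ℝ (Fin n)) : ℝ :=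
  (((n:ℝ) * ((n:ℝ) - 2 - 2*a)^2 / ((n:ℝ) - 2*(1+a-b))) ^
      (((n:ℝ) - 2*(1+a-b)) / (4*(1+a-b)))) *
  (1 + ‖x‖ ^ (2*((n:ℝ)-2-2*a)*(1+a-b) / ((n:ℝ)-2*(1+a-b)))) ^
    (-(((n:ℝ)-2*(1+a-b)) / (2*(1+a-b))))

/-- The rescaled bubble `U_μ(x) = μ^(-(n-2-2a)/2) U(x/μ)`. -/
def bubbleMu (n : ℕ) (a b μ : ℝ) (x : EuclideanSpace ℝ (Fin n)) : ℝ :=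
  μ ^ (-(((n:ℝ)-2-2*a)/2)) * bubble n a b (μ⁻¹ • x)

/-- `g` is differentiable near `s`, with first derivative `a` and second derivative `b` at `s`. -/
def HasD2 {V : Type*} [NormedAddCommGroup V] [NormedSpace ℝ V] (g : ℝ → V) (s : ℝ) (a b : V) :
    Prop :=
  ∃ g' : ℝ → V, (∀ᶠ t in 𝓝 s, HasDerivAt g (g' t) t) ∧ g' s = a ∧ HasDerivAt g' b s

namespace HasD2

variable {V W : Type*} [NormedAddCommGroup V] [NormedSpace ℝ V]
  [NormedAddCommGroup W] [NormedSpace ℝ W]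

lemma hasDerivAt {g : ℝ → V} {s : ℝ} {a b : V} (h : HasD2 g s a b) : HasDerivAt g a s := by
  obtain ⟨g', h1, h2, -⟩ := h
  rw [← h2]
  exact h1.self_of_nhds

lemma deriv_deriv {g : ℝ → V} {s : ℝ} {a b : V} (h : HasD2 g s a b) :
    deriv (deriv g) s = b := by
  obtain ⟨g', h1, h2, h3⟩ := h
  have : deriv g =ᶠ[𝓝 s] g' := h1.mono fun t ht => ht.deriv
  rw [this.deriv_eq, h3.deriv]

lemma congr_val {g : ℝ → V} {s : ℝ} {a b a' b' : V} (h : HasD2 g s a b) (ha : a = a')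
    (hb : b = b') : HasD2 g s a' b' := ha ▸ hb ▸ h

lemma congr {g g₂ : ℝ → V} {s : ℝ} {a b : V} (h : HasD2 g s a b) (hg : g₂ =ᶠ[𝓝 s] g) :
    HasD2 g₂ s a b := by
  obtain ⟨g', h1, h2, h3⟩ := h
  refine ⟨g', ?_, h2, h3⟩
  filter_upwards [h1, hg.eventually_nhds] with t ht ht2
  exact ht.congr_of_eventuallyEq ht2

lemma add {f g : ℝ → V} {s : ℝ} {a b c d : V} (hf : HasD2 f s a b) (hg : HasD2 g s c d) :
    HasD2 (fun t => f t + g t) s (a + c) (b + d) := by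
  obtain ⟨f', h1, h2, h3⟩ := hf
  obtain ⟨g', k1, k2, k3⟩ := hg
  refine ⟨fun t => f' t + g' t, ?_, by simp [h2, k2], h3.fun_add k3⟩
  filter_upwards [h1, k1] with t ht kt using ht.fun_add kt

lemma smul {f : ℝ → ℝ} {g : ℝ → V} {s : ℝ} {a b : ℝ} {c d : V} (hf : HasD2 f s a b)
    (hg : HasD2 g s c d) :
    HasD2 (fun t => f t • g t) s (f s • c + a • g s) (f s • d + (2 * a) • c + b • g s) := by
  have hg0 := hg.hasDerivAt
  have hf0 := hf.hasDerivAt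
  obtain ⟨f', h1, h2, h3⟩ := hf
  obtain ⟨g', k1, k2, k3⟩ := hg
  refine ⟨fun t => f t • g' t + f' t • g t, ?_, by simp [h2, k2], ?_⟩
  · filter_upwards [h1, k1] with t ht kt using ht.fun_smul kt
  · refine ((hf0.fun_smul k3).fun_add (h3.fun_smul hg0)).congr_deriv ?_
    rw [h2, k2, two_mul, add_smul]
    abel

lemma mul {f g : ℝ → ℝ} {s a b c d : ℝ} (hf : HasD2 f s a b) (hg : HasD2 g s c d) :
    HasD2 (fun t => f t * g t) s (f s * c + a * g s) (f s * d + 2 * a * c + b * g s) :=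
  hf.smul hg

lemma const (v : V) (s : ℝ) : HasD2 (fun _ => v) s 0 0 :=
  ⟨fun _ => 0, Eventually.of_forall fun t => hasDerivAt_const t v, rfl, hasDerivAt_const s 0⟩

lemma line (x e : V) (s : ℝ) : HasD2 (fun t : ℝ => x + t • e) s e 0 := by
  refine ⟨fun _ => e, Eventually.of_forall fun t => ?_, rfl, hasDerivAt_const s e⟩
  simpa using ((hasDerivAt_id t).smul_const e).const_add x

/-- Second-order chain rule for real functions of a real variable. -/
lemma comp {f g : ℝ → ℝ} {s A B a b : ℝ} (hf : HasD2 f (g s) A B) (hg : HasD2 g s a b) :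
    HasD2 (fun t => f (g t)) s (A * a) (B * a ^ 2 + A * b) := by
  have hg0 := hg.hasDerivAt
  obtain ⟨f', h1, h2, h3⟩ := hf
  obtain ⟨g', k1, k2, k3⟩ := hg
  refine ⟨fun t => f' (g t) * g' t, ?_, by simp [h2, k2], ?_⟩
  · filter_upwards [k1, hg0.continuousAt.eventually h1] with t kt ht using ht.comp t kt
  · refine ((h3.comp s hg0).fun_mul k3).congr_deriv ?_
    simp only [Function.comp, h2, k2]
    ring

/-- Second-order chain rule for a `C²` function along a curve. -/
lemma comp_curve {f : V → W} {c : ℝ → V} {s : ℝ} {a b : V} (hf : ContDiffAt ℝ 2 f (c s))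
    (hc : HasD2 c s a b) :
    HasD2 (fun t => f (c t)) s (fderiv ℝ f (c s) a)
      (fderiv ℝ (fderiv ℝ f) (c s) a a + fderiv ℝ f (c s) b) := by
  have hc0 := hc.hasDerivAt
  obtain ⟨c', k1, k2, k3⟩ := hc
  have hd : ∀ᶠ y in 𝓝 (c s), DifferentiableAt ℝ f y :=
    (hf.eventually (by simp)).mono fun y hy => hy.differentiableAt (by simp)
  have hd2 : DifferentiableAt ℝ (fderiv ℝ f) (c s) :=
    (hf.fderiv_right (m := 1) (by norm_num)).differentiableAt (by simp)
  refine ⟨fun t => fderiv ℝ f (c t) (c' t), ?_, by simp [k2], ?_⟩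
  · filter_upwards [k1, hc0.continuousAt.eventually hd] with t kt ht
    exact ht.hasFDerivAt.comp_hasDerivAt t kt
  · have := (hd2.hasFDerivAt.comp_hasDerivAt s hc0).clm_apply k3
    simpa [Function.comp, k2] using this

lemma rpow {s : ℝ} (hs : 0 < s) (k : ℝ) :
    HasD2 (fun t : ℝ => t ^ k) s (k * s ^ (k - 1)) (k * ((k - 1) * s ^ (k - 1 - 1))) := by
  refine ⟨fun t => k * t ^ (k - 1), ?_, rfl,
    (Real.hasDerivAt_rpow_const (Or.inl hs.ne')).const_mul k⟩
  filter_upwards [lt_mem_nhds hs] with t ht using Real.hasDerivAt_rpow_const (Or.inl ht.ne')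

end HasD2

section Laplacian

variable {n : ℕ}

lemma lapl_eq_sum {w : EuclideanSpace ℝ (Fin n) → ℝ} {x : EuclideanSpace ℝ (Fin n)}
    (hw : ContDiffAt ℝ 2 w x) :
    lapl w x = ∑ i : Fin n, fderiv ℝ (fderiv ℝ w) x (EuclideanSpace.single i 1)
      (EuclideanSpace.single i 1) := by
  have hd2 : DifferentiableAt ℝ (fderiv ℝ w) x :=
    (hw.fderiv_right (m := 1) (by norm_num)).differentiableAt (by simp)
  refine Finset.sum_congr rfl fun i _ => ?_
  rw [fderiv_clm_apply hd2 (differentiableAt_const _)]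
  simp

lemma lapl_eq_of_hasD2 {w : EuclideanSpace ℝ (Fin n) → ℝ} {x : EuclideanSpace ℝ (Fin n)}
    (hw : ContDiffAt ℝ 2 w x) {a b : Fin n → ℝ}
    (h : ∀ i, HasD2 (fun s : ℝ => w (x + s • EuclideanSpace.single i (1 : ℝ))) 0 (a i) (b i)) :
    lapl w x = ∑ i, b i := by
  rw [lapl_eq_sum hw]
  refine Finset.sum_congr rfl fun i _ => ?_
  have hline := HasD2.line x (EuclideanSpace.single i (1 : ℝ)) 0
  have h2 := HasD2.comp_curve (f := w) (by simpa using hw) hline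
  rw [← (h i).deriv_deriv, h2.deriv_deriv]
  simp

lemma ContDiffAt.hasD2_line {w : EuclideanSpace ℝ (Fin n) → ℝ} {x : EuclideanSpace ℝ (Fin n)}
    (hw : ContDiffAt ℝ 2 w x) (e : EuclideanSpace ℝ (Fin n)) :
    HasD2 (fun s : ℝ => w (x + s • e)) 0 (fderiv ℝ w x e)
      (fderiv ℝ (fderiv ℝ w) x e e) := by
  have h2 := HasD2.comp_curve (f := w) (by simpa using hw) (HasD2.line x e 0)
  simpa using h2

lemma hasD2_norm_sq_line (x : EuclideanSpace ℝ (Fin n)) (i : Fin n) :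
    HasD2 (fun s : ℝ => ‖x + s • EuclideanSpace.single i (1 : ℝ)‖ ^ 2) 0 (2 * x i) 2 := by
  have key : ∀ s : ℝ, ‖x + s • EuclideanSpace.single i (1 : ℝ)‖ ^ 2
      = ‖x‖ ^ 2 + 2 * x i * s + s ^ 2 := by
    intro s
    rw [norm_add_sq_real, inner_smul_right, norm_smul]
    simp [EuclideanSpace.inner_single_right]
    ring
  simp only [key]
  refine ⟨fun s => 2 * x i + 2 * s, Eventually.of_forall fun t => ?_, by simp, ?_⟩
  · have := (((hasDerivAt_id t).const_mul (2 * x i)).const_add (‖x‖ ^ 2)).fun_add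
      ((hasDerivAt_id t).pow 2)
    simpa using this
  · simpa using ((hasDerivAt_id (0 : ℝ)).const_mul 2).const_add (2 * x i)

lemma contDiffAt_norm_sq_comp {ψ : ℝ → ℝ} {x : EuclideanSpace ℝ (Fin n)}
    (hψ : ContDiffAt ℝ 2 ψ (‖x‖ ^ 2)) :
    ContDiffAt ℝ 2 (fun y : EuclideanSpace ℝ (Fin n) => ψ (‖y‖ ^ 2)) x :=
  hψ.comp x (contDiff_norm_sq ℝ).contDiffAt

lemma lapl_radial {ψ : ℝ → ℝ} {x : EuclideanSpace ℝ (Fin n)} {A B : ℝ}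
    (hψ : ContDiffAt ℝ 2 ψ (‖x‖ ^ 2)) (h : HasD2 ψ (‖x‖ ^ 2) A B) :
    lapl (fun y : EuclideanSpace ℝ (Fin n) => ψ (‖y‖ ^ 2)) x
      = 4 * ‖x‖ ^ 2 * B + 2 * n * A := by
  have h2 : ∀ i : Fin n, HasD2 (fun s : ℝ => ψ (‖x + s • EuclideanSpace.single i (1 : ℝ)‖ ^ 2)) 0
      (A * (2 * x i)) (B * (2 * x i) ^ 2 + A * 2) := fun i =>
    HasD2.comp (f := ψ) (by simpa using h) (hasD2_norm_sq_line x i)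
  rw [lapl_eq_of_hasD2 (contDiffAt_norm_sq_comp hψ) h2, EuclideanSpace.real_norm_sq_eq]
  simp only [Finset.sum_add_distrib, mul_pow, ← Finset.mul_sum]
  simp
  ring

lemma lapl_add {f g : EuclideanSpace ℝ (Fin n) → ℝ} {x : EuclideanSpace ℝ (Fin n)}
    (hf : ContDiffAt ℝ 2 f x) (hg : ContDiffAt ℝ 2 g x) :
    lapl (fun y => f y + g y) x = lapl f x + lapl g x := by
  rw [lapl_eq_of_hasD2 (hf.add hg) fun i => (hf.hasD2_line _).add (hg.hasD2_line _),
    lapl_eq_sum hf, lapl_eq_sum hg, Finset.sum_add_distrib]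

lemma lapl_const_mul {f : EuclideanSpace ℝ (Fin n) → ℝ} {x : EuclideanSpace ℝ (Fin n)}
    (hf : ContDiffAt ℝ 2 f x) (c : ℝ) :
    lapl (fun y => c * f y) x = c * lapl f x := by
  rw [lapl_eq_of_hasD2 (contDiffAt_const.mul hf) fun i =>
      (HasD2.const c 0).mul (hf.hasD2_line (EuclideanSpace.single i 1)),
    lapl_eq_sum hf, Finset.mul_sum]
  simp

lemma lapl_sub {f g : EuclideanSpace ℝ (Fin n) → ℝ} {x : EuclideanSpace ℝ (Fin n)}
    (hf : ContDiffAt ℝ 2 f x) (hg : ContDiffAt ℝ 2 g x) :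
    lapl (fun y => f y - g y) x = lapl f x - lapl g x := by
  have := lapl_add hf (contDiffAt_const.mul hg : ContDiffAt ℝ 2 (fun y => (-1 : ℝ) * g y) x)
  rw [lapl_const_mul hg] at this
  simpa [sub_eq_add_neg] using this

lemma lapl_const (c : ℝ) (x : EuclideanSpace ℝ (Fin n)) :
    lapl (fun _ : EuclideanSpace ℝ (Fin n) => c) x = 0 := by
  simp [lapl]

lemma lapl_comp_add_right (f : EuclideanSpace ℝ (Fin n) → ℝ) (c x : EuclideanSpace ℝ (Fin n)) :
    lapl (fun y => f (y + c)) x = lapl f (x + c) := by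
  simp only [lapl, fderiv_comp_add_right]
  refine Finset.sum_congr rfl fun i _ => ?_
  rw [fderiv_comp_add_right (f := fun y => fderiv ℝ f y (EuclideanSpace.single i 1))]

/-- The Newtonian potential `‖x - q‖ ^ (2 - n)`, written with the squared norm. -/
def newton (q x : EuclideanSpace ℝ (Fin n)) : ℝ := (‖x - q‖ ^ 2) ^ (-(((n : ℝ) - 2) / 2))

lemma contDiffAt_newton {q x : EuclideanSpace ℝ (Fin n)} (h : x ≠ q) :
    ContDiffAt ℝ 2 (newton q) x := by
  have : 0 < ‖x - q‖ ^ 2 := by have := norm_pos_iff.2 (sub_ne_zero.2 h); positivity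
  exact ((contDiff_norm_sq ℝ).contDiffAt.comp x (contDiffAt_id.sub contDiffAt_const)).rpow_const_of_ne
    this.ne'

lemma lapl_newton {q x : EuclideanSpace ℝ (Fin n)} (h : x ≠ q) : lapl (newton q) x = 0 := by
  have hx := norm_pos_iff.2 (sub_ne_zero.2 h)
  have hp : 0 < ‖x - q‖ ^ 2 := by positivity
  have := lapl_comp_add_right (fun y => (‖y‖ ^ 2) ^ (-(((n : ℝ) - 2) / 2))) (-q) x
  simp only [← sub_eq_add_neg] at this
  unfold newton
  rw [this, lapl_radial (ψ := fun t => t ^ (-(((n : ℝ) - 2) / 2)))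
    (Real.contDiffAt_rpow_const_of_ne hp.ne') (HasD2.rpow hp _)]
  set k := -(((n : ℝ) - 2) / 2)
  have h1 : (‖x - q‖ ^ 2) ^ (k - 1) = ‖x - q‖ ^ 2 * (‖x - q‖ ^ 2) ^ (k - 1 - 1) := by
    rw [Real.rpow_sub_one hp.ne' (k - 1)]; field_simp
  rw [h1]
  simp only [k]
  ring

lemma newton_pos {q x : EuclideanSpace ℝ (Fin n)} (h : x ≠ q) : 0 < newton q x :=
  Real.rpow_pos_of_pos (by have := norm_pos_iff.2 (sub_ne_zero.2 h); positivity) _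

/-- The Kelvin transform with respect to the sphere of radius `r` centred at the origin. -/
def kelvin (r : ℝ) (U : EuclideanSpace ℝ (Fin n) → ℝ) (y : EuclideanSpace ℝ (Fin n)) : ℝ :=
  (r ^ 2 / ‖y‖ ^ 2) ^ (((n : ℝ) - 2) / 2) * U ((r ^ 2 / ‖y‖ ^ 2) • y)

lemma contDiffAt_kelvin {r : ℝ} (hr : 0 < r) {U : EuclideanSpace ℝ (Fin n) → ℝ}
    {y : EuclideanSpace ℝ (Fin n)} (hy : y ≠ 0)
    (hU : ContDiffAt ℝ 2 U ((r ^ 2 / ‖y‖ ^ 2) • y)) : ContDiffAt ℝ 2 (kelvin r U) y := by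
  have hp := norm_pos_iff.2 hy
  have h1 : ContDiffAt ℝ 2 (fun y : EuclideanSpace ℝ (Fin n) => r ^ 2 / ‖y‖ ^ 2) y :=
    contDiffAt_const.div (contDiff_norm_sq ℝ).contDiffAt (by positivity)
  have h2 : ContDiffAt ℝ 2 (fun y : EuclideanSpace ℝ (Fin n) => (r ^ 2 / ‖y‖ ^ 2) • y) y :=
    h1.smul contDiffAt_id
  exact (h1.rpow_const_of_ne (by positivity)).mul (ContDiffAt.comp (g := U)
    (f := fun y : EuclideanSpace ℝ (Fin n) => (r ^ 2 / ‖y‖ ^ 2) • y) y hU h2)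

lemma lapl_kelvin {r : ℝ} (hr : 0 < r) {U : EuclideanSpace ℝ (Fin n) → ℝ}
    {y : EuclideanSpace ℝ (Fin n)} (hy : y ≠ 0)
    (hU : ContDiffAt ℝ 2 U ((r ^ 2 / ‖y‖ ^ 2) • y)) :
    lapl (kelvin r U) y = (r ^ 2 / ‖y‖ ^ 2) ^ (((n : ℝ) - 2) / 2) * (r ^ 2 / ‖y‖ ^ 2) ^ 2 *
      lapl U ((r ^ 2 / ‖y‖ ^ 2) • y) := by
  have hp := norm_pos_iff.2 hy
  set R := ‖y‖ ^ 2 with hR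
  have hRp : 0 < R := by positivity
  set τ := r ^ 2 / R with hτ
  have hτp : 0 < τ := by positivity
  set k := ((n : ℝ) - 2) / 2 with hk
  have hinv : HasD2 (fun t : ℝ => r ^ 2 / t) R (-τ / R) (2 * τ / R ^ 2) := by
    refine ⟨fun t => - r ^ 2 / t ^ 2, ?_, by simp only [hτ]; field_simp, ?_⟩
    · filter_upwards [lt_mem_nhds hRp] with t ht
      refine ((hasDerivAt_const t (r ^ 2)).fun_div (hasDerivAt_id t) ht.ne').congr_deriv ?_
      simp
    · refine ((hasDerivAt_const R (-r ^ 2)).fun_div (hasDerivAt_pow 2 R)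
        (by positivity)).congr_deriv ?_
      simp only [hτ]; field_simp; simp; ring
  have hψ : ∀ i : Fin n, HasD2 (fun s : ℝ => r ^ 2 / ‖y + s • EuclideanSpace.single i (1 : ℝ)‖ ^ 2) 0
      (-2 * τ * y i / R) (τ * (8 * (y i) ^ 2 / R ^ 2 - 2 / R)) := fun i =>
    (HasD2.comp (f := fun t : ℝ => r ^ 2 / t) (by simpa using hinv)
      (hasD2_norm_sq_line y i)).congr_val (by ring) (by ring)
  have hφ : ∀ i : Fin n, HasD2 (fun s : ℝ =>
      (r ^ 2 / ‖y + s • EuclideanSpace.single i (1 : ℝ)‖ ^ 2) ^ k) 0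
      (k * (-2 * y i / R) * τ ^ k)
      ((k * (k - 1) * (-2 * y i / R) ^ 2 + k * (8 * (y i) ^ 2 / R ^ 2 - 2 / R)) * τ ^ k) := by
    intro i
    refine (HasD2.comp (f := fun t : ℝ => t ^ k) (s := 0)
      (by simpa [← hR, ← hτ] using HasD2.rpow hτp k) (hψ i)).congr_val ?_ ?_
    · rw [Real.rpow_sub_one hτp.ne']; field_simp
    · rw [Real.rpow_sub_one hτp.ne', Real.rpow_sub_one hτp.ne']; field_simp
  have hc : ∀ i : Fin n, HasD2 (fun s : ℝ =>
      (r ^ 2 / ‖y + s • EuclideanSpace.single i (1 : ℝ)‖ ^ 2) •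
        (y + s • EuclideanSpace.single i (1 : ℝ))) 0
      (τ • EuclideanSpace.single i (1 : ℝ) + (-2 * τ * y i / R) • y)
      ((2 * (-2 * τ * y i / R)) • EuclideanSpace.single i (1 : ℝ) +
        (τ * (8 * (y i) ^ 2 / R ^ 2 - 2 / R)) • y) := by
    intro i
    refine ((hψ i).smul (HasD2.line y (EuclideanSpace.single i (1 : ℝ)) 0)).congr_val ?_ ?_
    · simp [← hR, ← hτ]
    · simp
  have hmain := fun i : Fin n => (hφ i).mul (HasD2.comp_curve (f := U)
    (by simpa [← hR, ← hτ] using hU) (hc i))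
  rw [lapl_eq_of_hasD2 (w := kelvin r U) (contDiffAt_kelvin hr hy hU) hmain, lapl_eq_sum hU]
  simp only [zero_smul, add_zero, ← hR, ← hτ]
  set L := fderiv ℝ U (τ • y)
  set B := fderiv ℝ (fderiv ℝ U) (τ • y)
  have hy_sum : y = ∑ i, y i • EuclideanSpace.single i (1 : ℝ) := by
    have := (EuclideanSpace.basisFun (Fin n) ℝ).sum_repr y
    simpa using this.symm
  have s1 : ∑ i, (y i) ^ 2 = R := by rw [hR, EuclideanSpace.real_norm_sq_eq]
  have s2 : ∑ i, y i * L (EuclideanSpace.single i (1 : ℝ)) = L y := by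
    conv_rhs => rw [hy_sum]
    simp
  have s3 : ∑ i, y i * B y (EuclideanSpace.single i (1 : ℝ)) = B y y := by
    conv_rhs => arg 2; rw [hy_sum]
    simp only [map_sum, map_smul, smul_eq_mul]
  have s4 : ∑ i, y i * B (EuclideanSpace.single i (1 : ℝ)) y = B y y := by
    conv_rhs => arg 1; rw [hy_sum]
    simp only [map_sum, map_smul, smul_eq_mul, _root_.sum_apply,
      _root_.smul_apply]
  simp only [map_add, map_smul, _root_.add_apply, _root_.smul_apply,
    smul_eq_mul]
  have expand : ∀ i : Fin n, _ = τ ^ k * ((4 * τ ^ 2 / R ^ 2 * B y y + 8 * τ / R ^ 2 * L y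
      + 8 * k * τ / R ^ 2 * L y + (k * (k - 1) * 4 / R ^ 2 + 8 * k / R ^ 2) * U (τ • y)) * (y i) ^ 2
      + (-2 * τ ^ 2 / R) * (y i * B y (EuclideanSpace.single i (1 : ℝ)))
      + (-2 * τ ^ 2 / R) * (y i * B (EuclideanSpace.single i (1 : ℝ)) y)
      + τ ^ 2 * B (EuclideanSpace.single i (1 : ℝ)) (EuclideanSpace.single i (1 : ℝ))
      + (-4 * τ / R - 4 * k * τ / R) * (y i * L (EuclideanSpace.single i (1 : ℝ)))
      + (- 2 * τ / R * L y - 2 * k / R * U (τ • y))) := fun i => rfl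
  rw [Finset.sum_congr rfl fun i _ => Eq.trans (by ring) (expand i).symm]
  simp only [← Finset.mul_sum, Finset.sum_add_distrib, s1, s2, s3, s4, Finset.sum_const,
    Finset.card_univ, Fintype.card_fin, nsmul_eq_mul]
  have hn : (n : ℝ) = 2 * k + 2 := by rw [hk]; ring
  rw [hn]
  field_simp
  ring

end Laplacian

lemma HasD2.nonneg_of_isLocalMin {g : ℝ → ℝ} {s a b : ℝ} (h : HasD2 g s a b)
    (hmin : IsLocalMin g s) : 0 ≤ b := by
  by_contra! hb
  have ha : a = 0 := hmin.hasDerivAt_eq_zero h.hasDerivAt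
  have hmax : IsLocalMax g s := by
    refine isLocalMax_of_deriv_deriv_neg (by rwa [h.deriv_deriv]) ?_ h.hasDerivAt.continuousAt
    rw [h.hasDerivAt.deriv, ha]
  have hc : g =ᶠ[𝓝 s] fun _ => g s := by
    filter_upwards [hmin, hmax] with t h1 h2 using le_antisymm h2 h1
  have := (HasD2.const (g s) s).congr hc
  rw [← h.deriv_deriv, this.deriv_deriv] at hb
  exact lt_irrefl _ hb

section MaximumPrinciple

variable {n : ℕ}

lemma lapl_nonneg_of_isLocalMin {f : EuclideanSpace ℝ (Fin n) → ℝ} {x : EuclideanSpace ℝ (Fin n)}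
    (hf : ContDiffAt ℝ 2 f x) (hmin : IsLocalMin f x) : 0 ≤ lapl f x := by
  rw [lapl_eq_sum hf]
  refine Finset.sum_nonneg fun i _ => (hf.hasD2_line _).nonneg_of_isLocalMin ?_
  have hc : ContinuousAt (fun s : ℝ => x + s • EuclideanSpace.single i (1 : ℝ)) 0 := by fun_prop
  have := hc.eventually (p := fun y => f x ≤ f y) (by
    have h : ∀ᶠ y in 𝓝 x, f x ≤ f y := hmin
    simpa using h)
  simpa [IsLocalMin, IsMinFilter] using this

lemma nonneg_of_lapl_neg {K : Set (EuclideanSpace ℝ (Fin n))} (hK : IsCompact K)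
    {f : EuclideanSpace ℝ (Fin n) → ℝ} (hf : ContinuousOn f K)
    (h : ∀ x ∈ K, f x < 0 → K ∈ 𝓝 x ∧ ContDiffAt ℝ 2 f x ∧ lapl f x < 0) :
    ∀ x ∈ K, 0 ≤ f x := by
  intro x hx
  obtain ⟨x₀, hx₀, hmin⟩ := hK.exists_isMinOn ⟨x, hx⟩ hf
  by_contra! hneg
  obtain ⟨h1, h2, h3⟩ := h x₀ hx₀ ((hmin hx).trans_lt hneg)
  exact absurd (lapl_nonneg_of_isLocalMin h2 (hmin.isLocalMin h1)) (not_le.2 h3)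

lemma mul_newton_zero {r : ℝ} (y : EuclideanSpace ℝ (Fin n)) :
    (r ^ 2) ^ (((n : ℝ) - 2) / 2) * newton 0 y = (r ^ 2 / ‖y‖ ^ 2) ^ (((n : ℝ) - 2) / 2) := by
  rw [newton, sub_zero, Real.rpow_neg (by positivity), Real.div_rpow (by positivity)
    (by positivity)]
  rfl

/-- A nonnegative strictly superharmonic function outside a ball, possibly singular at one point,
is bounded below by a multiple of the fundamental solution. -/
lemma le_of_superharmonic_exterior (hn : 3 ≤ n) {f : EuclideanSpace ℝ (Fin n) → ℝ}
    {q : EuclideanSpace ℝ (Fin n)} {r m : ℝ} (hr : 0 < r) (hq : r < ‖q‖) (hm : 0 ≤ m)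
    (hf : ∀ y, r ≤ ‖y‖ → y ≠ q → ContDiffAt ℝ 2 f y)
    (hneg : ∀ y, r < ‖y‖ → y ≠ q → lapl f y < 0)
    (h0 : ∀ y, r ≤ ‖y‖ → y ≠ q → 0 ≤ f y) (hmf : ∀ y, ‖y‖ = r → m ≤ f y)
    (y : EuclideanSpace ℝ (Fin n)) (hy : r ≤ ‖y‖) (hyq : y ≠ q) :
    m * (r ^ 2 / ‖y‖ ^ 2) ^ (((n : ℝ) - 2) / 2) ≤ f y := by
  set k := ((n : ℝ) - 2) / 2 with hk
  have hkp : 0 < k := by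
    have : (3 : ℝ) ≤ n := by exact_mod_cast hn
    rw [hk]; linarith
  set c := m * (r ^ 2) ^ k with hc
  have hcn : ∀ x : EuclideanSpace ℝ (Fin n), c * newton 0 x = m * (r ^ 2 / ‖x‖ ^ 2) ^ k := by
    intro x; rw [← mul_newton_zero, hc]; ring
  have hcm : ∀ x : EuclideanSpace ℝ (Fin n), r ≤ ‖x‖ → c * newton 0 x ≤ m := by
    intro x hx
    have hx0 : 0 < ‖x‖ := hr.trans_le hx
    rw [hcn]
    refine mul_le_of_le_one_right hm (Real.rpow_le_one (by positivity) ?_ hkp.le)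
    rw [div_le_one (by positivity)]
    gcongr
  rw [← hcn]
  have key : ∀ ε : ℝ, 0 < ε → c * newton 0 y ≤ f y + ε * (1 + newton q y) := by
    intro ε hε
    have t1 : Tendsto (fun R : ℝ => m * (r ^ 2 / R ^ 2) ^ k) atTop (𝓝 0) := by
      have h1 : Tendsto (fun R : ℝ => r ^ 2 / R ^ 2) atTop (𝓝 0) :=
        tendsto_const_nhds.div_atTop (tendsto_pow_atTop two_ne_zero)
      simpa [Real.zero_rpow hkp.ne'] using
        (h1.rpow_const (p := k) (Or.inr hkp.le)).const_mul m
    have t2 : Tendsto (fun η : ℝ => (η ^ 2) ^ (-k)) (𝓝[>] 0) atTop := by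
      refine (tendsto_rpow_neg_nhdsGT_zero (neg_lt_zero.2 hkp)).comp ?_
      rw [tendsto_nhdsWithin_iff]
      refine ⟨?_, ?_⟩
      · have : Tendsto (fun η : ℝ => η ^ 2) (𝓝 0) (𝓝 (0 ^ 2)) := (continuous_pow 2).tendsto 0
        simpa using this.mono_left nhdsWithin_le_nhds
      · filter_upwards [self_mem_nhdsWithin] with η hη
        have : (0 : ℝ) < η := hη
        exact pow_pos this 2
    obtain ⟨R, hR1, hR2⟩ := ((t1.eventually (ge_mem_nhds hε)).and
      (eventually_ge_atTop ‖y‖)).exists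
    have hyq' : 0 < ‖y - q‖ := norm_pos_iff.2 (sub_ne_zero.2 hyq)
    obtain ⟨η, hη1, hη2, hη3⟩ := ((t2.eventually_ge_atTop (m / ε)).and
      (Ioo_mem_nhdsGT hyq')).exists
    set K : Set (EuclideanSpace ℝ (Fin n)) := {x | r ≤ ‖x‖ ∧ ‖x‖ ≤ R ∧ η ≤ ‖x - q‖} with hKdef
    have hK : IsCompact K := by
      refine (isCompact_closedBall (0 : EuclideanSpace ℝ (Fin n)) R).of_isClosed_subset ?_ ?_
      · exact (isClosed_le continuous_const continuous_norm).inter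
          ((isClosed_le continuous_norm continuous_const).inter
            (isClosed_le continuous_const (continuous_id.sub continuous_const).norm))
      · intro x hx; simpa using hx.2.1
    have hreg : ∀ x ∈ K, x ≠ q ∧ x ≠ 0 := by
      intro x hx
      refine ⟨?_, norm_pos_iff.1 (hr.trans_le hx.1)⟩
      rintro rfl
      have := hx.2.2
      simp only [sub_self, norm_zero] at this
      have := hη2
      grind
    have hg : ∀ x ∈ K, ContDiffAt ℝ 2 (fun x => f x - c * newton 0 x) x ∧
        ContDiffAt ℝ 2 (fun x => ε * 1 + ε * newton q x) x := fun x hx =>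
      ⟨(hf x hx.1 (hreg x hx).1).sub (contDiffAt_const.mul (contDiffAt_newton (hreg x hx).2)),
        contDiffAt_const.add (contDiffAt_const.mul (contDiffAt_newton (hreg x hx).1))⟩
    have hmain := nonneg_of_lapl_neg hK
      (f := fun x => (f x - c * newton 0 x) + (ε * 1 + ε * newton q x))
      (fun x hx => ((hg x hx).1.add (hg x hx).2).continuousAt.continuousWithinAt) ?_ y
      ⟨hy, hR2, hη3.le⟩
    · linarith
    · intro x hx hneg'
      have hxq := (hreg x hx).1
      have hN : 0 < newton q x := newton_pos hxq
      have hf0 := h0 x hx.1 hxq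
      have hεN := mul_pos hε hN
      have hx1 : r < ‖x‖ := by
        refine lt_of_le_of_ne hx.1 fun h => ?_
        have := hmf x h.symm
        have := hcm x hx.1
        linarith
      have hx2 : ‖x‖ < R := by
        refine lt_of_le_of_ne hx.2.1 fun h => ?_
        rw [← h, ← hcn] at hR1
        linarith
      have hx3 : η < ‖x - q‖ := by
        refine lt_of_le_of_ne hx.2.2 fun h => ?_
        have : m / ε ≤ newton q x := by rw [newton, ← h]; exact hη1
        rw [div_le_iff₀' hε] at this
        have := hcm x hx.1
        linarith
      refine ⟨?_, (hg x hx).1.add (hg x hx).2, ?_⟩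
      · filter_upwards [(continuous_norm.tendsto x).eventually (lt_mem_nhds hx1),
          (continuous_norm.tendsto x).eventually (gt_mem_nhds hx2),
          ((continuous_norm.comp (continuous_id.sub continuous_const)).tendsto x).eventually
            (lt_mem_nhds hx3)] with z h1 h2 h3 using ⟨h1.le, h2.le, h3.le⟩
      · rw [lapl_add (hg x hx).1 (hg x hx).2, lapl_sub (hf x hx.1 hxq)
          (contDiffAt_const.mul (contDiffAt_newton (hreg x hx).2)),
          lapl_add contDiffAt_const (contDiffAt_const.mul (contDiffAt_newton hxq)),
          lapl_const_mul (contDiffAt_newton hxq), lapl_const_mul (contDiffAt_newton (hreg x hx).2),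
          lapl_newton hxq, lapl_newton (hreg x hx).2, lapl_const]
        have := hneg x hx1 hxq
        linarith
  refine le_of_forall_pos_le_add fun δ hδ => ?_
  have hN : 0 < newton q y := newton_pos hyq
  have := key (δ / (1 + newton q y)) (by positivity)
  rwa [div_mul_cancel₀ _ (by positivity)] at this

/-- Barrier from below on an annulus. -/
lemma le_of_superharmonic_annulus {f : EuclideanSpace ℝ (Fin n) → ℝ} {r r₁ m : ℝ} (hr : 0 < r)
    (hm : 0 ≤ m) (hf : ∀ y, r ≤ ‖y‖ → ‖y‖ ≤ r₁ → ContDiffAt ℝ 2 f y)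
    (hneg : ∀ y, r < ‖y‖ → ‖y‖ < r₁ → lapl f y < 0)
    (h0 : ∀ y, ‖y‖ = r → 0 ≤ f y) (hmf : ∀ y, ‖y‖ = r₁ → m ≤ f y)
    (y : EuclideanSpace ℝ (Fin n)) (hy : r ≤ ‖y‖) (hy₁ : ‖y‖ ≤ r₁) :
    m * (1 - (r ^ 2 / ‖y‖ ^ 2) ^ (((n : ℝ) - 2) / 2)) ≤ f y := by
  set k := ((n : ℝ) - 2) / 2 with hk
  set c := m * (r ^ 2) ^ k with hc
  have hcn : ∀ x : EuclideanSpace ℝ (Fin n), c * newton 0 x = m * (r ^ 2 / ‖x‖ ^ 2) ^ k := by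
    intro x; rw [← mul_newton_zero, hc]; ring
  set K : Set (EuclideanSpace ℝ (Fin n)) := {x | r ≤ ‖x‖ ∧ ‖x‖ ≤ r₁} with hKdef
  have hK : IsCompact K := by
    refine (isCompact_closedBall (0 : EuclideanSpace ℝ (Fin n)) r₁).of_isClosed_subset ?_ ?_
    · exact (isClosed_le continuous_const continuous_norm).inter
        (isClosed_le continuous_norm continuous_const)
    · intro x hx; simpa using hx.2
  have hx0 : ∀ x ∈ K, x ≠ 0 := fun x hx => norm_pos_iff.1 (hr.trans_le hx.1)
  have hg : ∀ x ∈ K, ContDiffAt ℝ 2 (fun x => c * newton 0 x - m) x := fun x hx =>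
    (contDiffAt_const.mul (contDiffAt_newton (hx0 x hx))).sub contDiffAt_const
  have hmain := nonneg_of_lapl_neg hK (f := fun x => f x + (c * newton 0 x - m))
    (fun x hx => ((hf x hx.1 hx.2).add (hg x hx)).continuousAt.continuousWithinAt) ?_ y ⟨hy, hy₁⟩
  · rw [hcn] at hmain; linarith
  · intro x hx hneg'
    have hcx : 0 ≤ c * newton 0 x := by rw [hcn]; positivity
    have hx1 : r < ‖x‖ := by
      refine lt_of_le_of_ne hx.1 fun h => ?_
      have h1 := h0 x h.symm
      rw [hcn, ← h, div_self (by positivity), Real.one_rpow] at hneg'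
      linarith
    have hx2 : ‖x‖ < r₁ := by
      refine lt_of_le_of_ne hx.2 fun h => ?_
      have := hmf x h
      linarith
    refine ⟨?_, (hf x hx.1 hx.2).add (hg x hx), ?_⟩
    · filter_upwards [(continuous_norm.tendsto x).eventually (lt_mem_nhds hx1),
        (continuous_norm.tendsto x).eventually (gt_mem_nhds hx2)] with z h1 h2 using ⟨h1.le, h2.le⟩
    · rw [lapl_add (hf x hx.1 hx.2) (hg x hx), lapl_sub
        (contDiffAt_const.mul (contDiffAt_newton (hx0 x hx))) contDiffAt_const,
        lapl_const_mul (contDiffAt_newton (hx0 x hx)), lapl_newton (hx0 x hx), lapl_const]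
      have := hneg x hx1 hx2
      linarith

end MaximumPrinciple

section MovingSpheres

variable {n : ℕ}

lemma norm_inversion_smul {r : ℝ} {y : EuclideanSpace ℝ (Fin n)} (hy : y ≠ 0) :
    ‖(r ^ 2 / ‖y‖ ^ 2) • y‖ = r ^ 2 / ‖y‖ := by
  have := norm_pos_iff.2 hy
  rw [norm_smul, Real.norm_of_nonneg (by positivity)]
  field_simp

lemma norm_inversion_le {r : ℝ} (hr : 0 < r) {y : EuclideanSpace ℝ (Fin n)} (hy : r ≤ ‖y‖) :
    ‖(r ^ 2 / ‖y‖ ^ 2) • y‖ ≤ r := by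
  have h : 0 < ‖y‖ := hr.trans_le hy
  rw [norm_inversion_smul (norm_pos_iff.1 h), div_le_iff₀ h, pow_two]
  gcongr

/-- Comparison with the Kelvin transform along a ray on which `t ^ ((n - 2) / 2) * U (t • y)` is
nondecreasing. -/
lemma kelvin_le_of_ray {r : ℝ} (hr : 0 < r) {U : EuclideanSpace ℝ (Fin n) → ℝ}
    {y : EuclideanSpace ℝ (Fin n)} (hy : r ≤ ‖y‖)
    (hd : ∀ t, r ^ 2 / ‖y‖ ^ 2 ≤ t → t ≤ 1 → DifferentiableAt ℝ U (t • y) ∧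
      0 ≤ ((n : ℝ) - 2) / 2 * U (t • y) + fderiv ℝ U (t • y) (t • y)) :
    kelvin r U y ≤ U y := by
  set k := ((n : ℝ) - 2) / 2 with hk
  set τ := r ^ 2 / ‖y‖ ^ 2 with hτ
  have hy0 : 0 < ‖y‖ := hr.trans_le hy
  have hτ0 : 0 < τ := by positivity
  have hτ1 : τ ≤ 1 := by
    rw [hτ, div_le_one (by positivity)]
    gcongr
  have hder : ∀ t, τ ≤ t → t ≤ 1 → HasDerivAt (fun t : ℝ => t ^ k * U (t • y))
      (t ^ (k - 1) * (k * U (t • y) + fderiv ℝ U (t • y) (t • y))) t := by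
    intro t h1 h2
    have ht : 0 < t := hτ0.trans_le h1
    have hc : HasDerivAt (fun t : ℝ => t • y) y t := by
      simpa using (hasDerivAt_id t).smul_const y
    refine ((Real.hasDerivAt_rpow_const (p := k) (Or.inl ht.ne')).fun_mul
      ((hd t h1 h2).1.hasFDerivAt.comp_hasDerivAt t hc)).congr_deriv ?_
    simp only [Function.comp, map_smul, smul_eq_mul]
    rw [Real.rpow_sub_one ht.ne']
    field_simp
  have hmono : MonotoneOn (fun t : ℝ => t ^ k * U (t • y)) (Set.Icc τ 1) := by
    refine monotoneOn_of_deriv_nonneg (convex_Icc _ _)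
      (fun t ht => (hder t ht.1 ht.2).continuousAt.continuousWithinAt)
      (fun t ht => ?_) (fun t ht => ?_)
    all_goals rw [interior_Icc] at ht
    · exact (hder t ht.1.le ht.2.le).differentiableAt.differentiableWithinAt
    · rw [(hder t ht.1.le ht.2.le).deriv]
      exact mul_nonneg (Real.rpow_nonneg (hτ0.trans ht.1).le _) (hd t ht.1.le ht.2.le).2
  have := hmono ⟨le_rfl, hτ1⟩ ⟨hτ1, le_rfl⟩ hτ1
  simpa [kelvin] using this

variable {U : EuclideanSpace ℝ (Fin n) → ℝ} {q : EuclideanSpace ℝ (Fin n)}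

lemma eventually_kelvin_le (hn : 3 ≤ n) (hq : q ≠ 0) (hU : ∀ y, y ≠ q → ContDiffAt ℝ 2 U y)
    (hpos : ∀ y, y ≠ q → 0 < U y) (hlap : ∀ y, y ≠ q → lapl U y < 0) :
    ∀ᶠ r in 𝓝[>] (0 : ℝ), ∀ y, r ≤ ‖y‖ → y ≠ q → kelvin r U y ≤ U y := by
  set k := ((n : ℝ) - 2) / 2 with hk
  have hkp : 0 < k := by
    have : (3 : ℝ) ≤ n := by exact_mod_cast hn
    rw [hk]; linarith
  have hΘc : ContinuousAt (fun y => k * U y + fderiv ℝ U y y) 0 :=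
    ((hU 0 hq.symm).continuousAt.const_mul k).add
      (((hU 0 hq.symm).fderiv_right (m := 1) (by norm_num)).continuousAt.clm_apply continuousAt_id)
  have hΘ0 : 0 < k * U 0 + fderiv ℝ U 0 0 := by simpa using mul_pos hkp (hpos 0 hq.symm)
  obtain ⟨ε, hε, hΘ⟩ := Metric.eventually_nhds_iff.1 (hΘc.eventually (lt_mem_nhds hΘ0))
  have hqn := norm_pos_iff.2 hq
  set δ := min (ε / 2) (‖q‖ / 2) with hδ
  have hδ0 : 0 < δ := by positivity
  have hδε : δ < ε := (min_le_left _ _).trans_lt (by linarith)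
  have hδq : δ < ‖q‖ := (min_le_right _ _).trans_lt (by linarith)
  have hne : ∀ y : EuclideanSpace ℝ (Fin n), ‖y‖ ≤ δ → y ≠ q := by
    rintro y hy rfl; linarith
  have hcont : ContinuousOn U (Metric.closedBall 0 δ) := fun y hy =>
    (hU y (hne y (by simpa using hy))).continuousAt.continuousWithinAt
  have hcomp := isCompact_closedBall (0 : EuclideanSpace ℝ (Fin n)) δ
  obtain ⟨m, hm0, hm⟩ := hcomp.exists_forall_le' hcont (a := 0)
    fun y hy => hpos y (hne y (by simpa using hy))
  obtain ⟨M, hM⟩ := hcomp.bddAbove_image hcont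
  have hfar := le_of_superharmonic_exterior hn hδ0 hδq hm0.le (f := U) (q := q)
    (fun y _ => hU y) (fun y _ => hlap y) (fun y _ h => (hpos y h).le)
    (fun y hy => hm y (by simpa using hy.le))
  have hlim : Tendsto (fun r : ℝ => (r ^ 2) ^ k * M) (𝓝[>] 0) (𝓝 0) := by
    have : Tendsto (fun r : ℝ => (r ^ 2) ^ k * M) (𝓝 0) (𝓝 (((0 : ℝ) ^ 2) ^ k * M)) :=
      ((((continuous_pow 2).tendsto (0 : ℝ)).rpow_const (Or.inr hkp.le))).mul_const M
    rw [zero_pow two_ne_zero, Real.zero_rpow hkp.ne', zero_mul] at this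
    exact this.mono_left nhdsWithin_le_nhds
  filter_upwards [hlim.eventually (gt_mem_nhds (show 0 < m * (δ ^ 2) ^ k by positivity)),
    Ioo_mem_nhdsGT hδ0] with r hr1 hr2 y hy hyq
  have hr0 : 0 < r := hr2.1
  have hy0 : 0 < ‖y‖ := hr0.trans_le hy
  rcases le_or_gt ‖y‖ δ with h | h
  · refine kelvin_le_of_ray hr0 hy fun t ht1 ht2 => ?_
    have ht0 : 0 < t := lt_of_lt_of_le (by positivity) ht1
    have hty : ‖t • y‖ ≤ δ := by
      rw [norm_smul, Real.norm_of_nonneg ht0.le]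
      nlinarith
    exact ⟨(hU _ (hne _ hty)).differentiableAt (by simp),
      (hΘ (by rw [dist_zero_right]; linarith)).le⟩
  · refine le_trans ?_ (hfar y h.le hyq)
    have h1 : U ((r ^ 2 / ‖y‖ ^ 2) • y) ≤ M := by
      refine hM ⟨_, ?_, rfl⟩
      have := norm_inversion_le hr0 hy
      simp only [Metric.mem_closedBall, dist_zero_right]
      exact this.trans hr2.2.le
    rw [kelvin, Real.div_rpow (by positivity) (by positivity),
      Real.div_rpow (by positivity) (by positivity)]
    have hy2 : 0 < (‖y‖ ^ 2) ^ k := by positivity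
    have hr3 : 0 ≤ (r ^ 2) ^ k := by positivity
    calc (r ^ 2) ^ k / (‖y‖ ^ 2) ^ k * U ((r ^ 2 / ‖y‖ ^ 2) • y)
        ≤ (r ^ 2) ^ k / (‖y‖ ^ 2) ^ k * M := by gcongr
      _ = ((r ^ 2) ^ k * M) / (‖y‖ ^ 2) ^ k := by ring
      _ ≤ (m * (δ ^ 2) ^ k) / (‖y‖ ^ 2) ^ k := by gcongr
      _ = _ := by ring

lemma inversion_ne {r : ℝ} (hr : 0 < r) (hrq : r < ‖q‖) {y : EuclideanSpace ℝ (Fin n)}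
    (hy : r ≤ ‖y‖) : (r ^ 2 / ‖y‖ ^ 2) • y ≠ q := by
  rintro h
  have := norm_inversion_le hr hy
  rw [h] at this
  linarith

lemma contDiffAt_sub_kelvin (hU : ∀ y, y ≠ q → ContDiffAt ℝ 2 U y) {r : ℝ} (hr : 0 < r)
    (hrq : r < ‖q‖) {y : EuclideanSpace ℝ (Fin n)} (hy : r ≤ ‖y‖) (hyq : y ≠ q) :
    ContDiffAt ℝ 2 (fun y => U y - kelvin r U y) y :=
  (hU y hyq).sub (contDiffAt_kelvin hr (norm_pos_iff.1 (hr.trans_le hy))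
    (hU _ (inversion_ne hr hrq hy)))

/-- Hopf-type boundary estimate. -/
lemma radial_pos_of_kelvin_le {r : ℝ} (hr : 0 < r) (hrq : r < ‖q‖)
    (hn : 3 ≤ n) (hU : ∀ y, y ≠ q → ContDiffAt ℝ 2 U y)
    (hlap : ∀ y, r < ‖y‖ → y ≠ q → lapl (fun y => U y - kelvin r U y) y < 0) {r₁ m : ℝ}
    (hr₁ : r < r₁) (hr₁q : r₁ < ‖q‖) (hm : 0 < m) (hmD : ∀ y, ‖y‖ = r₁ → m ≤ U y - kelvin r U y)
    {y : EuclideanSpace ℝ (Fin n)} (hy : ‖y‖ = r) :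
    0 < ((n : ℝ) - 2) / 2 * U y + fderiv ℝ U y y := by
  have hbar := le_of_superharmonic_annulus (f := fun y => U y - kelvin r U y) hr hm.le (r₁ := r₁)
    (fun y h1 h2 => contDiffAt_sub_kelvin hU hr hrq h1 (by rintro rfl; linarith))
    (fun y h1 h2 => hlap y h1 (by rintro rfl; linarith))
    (fun y hy => by
      have : 0 < ‖y‖ := by rw [hy]; exact hr
      simp [kelvin, ← hy, this.ne']) hmD
  set k := ((n : ℝ) - 2) / 2 with hk
  have hkp : 0 < k := by
    have : (3 : ℝ) ≤ n := by exact_mod_cast hn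
    rw [hk]; linarith
  have hyq : y ≠ q := by rintro rfl; linarith
  have hUd := ((hU y hyq).differentiableAt (by simp)).hasFDerivAt
  set φ : ℝ → ℝ := fun t => U (t • y) - ((t⁻¹) ^ 2) ^ k * U (t⁻¹ • y) - m * (1 - ((t⁻¹) ^ 2) ^ k)
    with hφ
  have h1 : HasDerivAt (fun t : ℝ => U (t • y)) (fderiv ℝ U y y) 1 := by
    have hc : HasDerivAt (fun t : ℝ => t • y) y 1 := by
      simpa using (hasDerivAt_id (1 : ℝ)).smul_const y
    exact HasFDerivAt.comp_hasDerivAt (l := U) (1 : ℝ) (by simpa using hUd) hc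
  have hinv : HasDerivAt (fun t : ℝ => t⁻¹) (-1) 1 := by
    simpa using hasDerivAt_inv (one_ne_zero (α := ℝ))
  have h2 : HasDerivAt (fun t : ℝ => U (t⁻¹ • y)) (-fderiv ℝ U y y) 1 := by
    have := HasDerivAt.scomp (1 : ℝ) (g₁ := fun t : ℝ => U (t • y)) (h := fun t : ℝ => t⁻¹)
      (by simpa using h1) hinv
    simpa [Function.comp_def] using this
  have h3 : HasDerivAt (fun t : ℝ => ((t⁻¹) ^ 2) ^ k) (-2 * k) 1 := by
    have := (hinv.fun_pow 2).rpow_const (p := k) (by simp)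
    refine this.congr_deriv ?_
    simp
  have hφ' : HasDerivAt φ (2 * (k * U y + fderiv ℝ U y y) - 2 * k * m) 1 := by
    refine ((h1.fun_sub (h3.fun_mul h2)).fun_sub
      (((hasDerivAt_const (1 : ℝ) (1 : ℝ)).fun_sub h3).const_mul m)).congr_deriv ?_
    simp
    ring
  have hφ1 : φ 1 = 0 := by simp [hφ]
  have hnn : 0 ≤ 2 * (k * U y + fderiv ℝ U y y) - 2 * k * m := by
    refine ge_of_tendsto hφ'.tendsto_slope_zero_right ?_
    have hh : 0 < r₁ / r - 1 := by rw [sub_pos, one_lt_div hr]; exact hr₁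
    filter_upwards [Ioo_mem_nhdsGT hh] with s hs
    rw [hφ1, sub_zero, smul_eq_mul]
    refine mul_nonneg (inv_nonneg.2 hs.1.le) ?_
    have ht : 0 < 1 + s := by linarith [hs.1]
    have hnorm : ‖(1 + s) • y‖ = (1 + s) * r := by
      rw [norm_smul, Real.norm_of_nonneg ht.le, hy]
    have hs2 : (1 + s) * r ≤ r₁ := by
      have := hs.2
      rw [lt_sub_iff_add_lt, lt_div_iff₀ hr] at this
      linarith
    have hb := hbar ((1 + s) • y) (by rw [hnorm]; nlinarith [hs.1]) (by rw [hnorm]; exact hs2)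
    have he : r ^ 2 / ‖(1 + s) • y‖ ^ 2 = ((1 + s)⁻¹) ^ 2 := by
      rw [hnorm]; field_simp
    simp only [kelvin, he, ← hk, smul_smul] at hb
    have he2 : ((1 + s)⁻¹) ^ 2 * (1 + s) = (1 + s)⁻¹ := by field_simp
    rw [he2] at hb
    simp only [hφ]
    linarith
  nlinarith [mul_pos hkp hm]

lemma kelvin_lt_of_le {r : ℝ} (hr : 0 < r) (hrq : r < ‖q‖)
    (hU : ∀ y, y ≠ q → ContDiffAt ℝ 2 U y)
    (hD : ∀ y, r ≤ ‖y‖ → y ≠ q → kelvin r U y ≤ U y)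
    (hlap : ∀ y, r < ‖y‖ → y ≠ q → lapl (fun y => U y - kelvin r U y) y < 0)
    {y : EuclideanSpace ℝ (Fin n)} (hy : r < ‖y‖) (hyq : y ≠ q) : kelvin r U y < U y := by
  refine lt_of_le_of_ne (hD y hy.le hyq) fun h => ?_
  refine absurd (hlap y hy hyq) (not_lt.2 (lapl_nonneg_of_isLocalMin
    (contDiffAt_sub_kelvin hU hr hrq hy.le hyq) ?_))
  filter_upwards [(continuous_norm.tendsto y).eventually (lt_mem_nhds hy),
    isOpen_ne.mem_nhds hyq] with z h1 h2
  rw [h, sub_self]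
  exact sub_nonneg.2 (hD z h1.le h2)

/-- The set of radii for which the moving sphere comparison holds is open to the right. -/
lemma eventually_kelvin_le_of_kelvin_le (hn : 3 ≤ n) {r : ℝ} (hr : 0 < r) (hrq : r < ‖q‖)
    (hU : ∀ y, y ≠ q → ContDiffAt ℝ 2 U y)
    (hD : ∀ y, r ≤ ‖y‖ → y ≠ q → kelvin r U y ≤ U y)
    (hlap : ∀ y, r < ‖y‖ → y ≠ q → lapl (fun y => U y - kelvin r U y) y < 0) :
    ∀ᶠ r' in 𝓝[>] r, ∀ y, r' ≤ ‖y‖ → y ≠ q → kelvin r' U y ≤ U y := by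
  have hmin : ∀ ρ, r < ρ → ρ < ‖q‖ → ∃ m, 0 < m ∧ ∀ y, ‖y‖ = ρ → m ≤ U y - kelvin r U y := by
    intro ρ h1 h2
    have hne : ∀ y ∈ Metric.sphere (0 : EuclideanSpace ℝ (Fin n)) ρ, ‖y‖ = ρ ∧ y ≠ q := by
      intro y hy
      have : ‖y‖ = ρ := by simpa using hy
      exact ⟨this, by rintro rfl; linarith⟩
    obtain ⟨m, hm0, hm⟩ := (isCompact_sphere (0 : EuclideanSpace ℝ (Fin n)) ρ).exists_forall_le'
      (f := fun y => U y - kelvin r U y) (a := 0)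
      (fun y hy => (contDiffAt_sub_kelvin hU hr hrq (by rw [(hne y hy).1]; exact h1.le)
        (hne y hy).2).continuousAt.continuousWithinAt)
      (fun y hy => sub_pos.2 (kelvin_lt_of_le hr hrq hU hD hlap (by rw [(hne y hy).1]; exact h1)
        (hne y hy).2))
    exact ⟨m, hm0, fun y hy => hm y (by simpa using hy)⟩
  set k := ((n : ℝ) - 2) / 2 with hk
  have hkp : 0 < k := by
    have : (3 : ℝ) ≤ n := by exact_mod_cast hn
    rw [hk]; linarith
  obtain ⟨r₁, hr₁, hr₁q⟩ := exists_between hrq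
  obtain ⟨m, hm0, hm⟩ := hmin r₁ hr₁ hr₁q
  have hshell : ∀ᶠ t in 𝓝 (1 : ℝ), ∀ y ∈ Metric.sphere (0 : EuclideanSpace ℝ (Fin n)) r,
      0 < k * U (t • y) + fderiv ℝ U (t • y) (t • y) := by
    refine (isCompact_sphere _ _).eventually_forall_of_forall_eventually fun y hy => ?_
    have hy' : ‖y‖ = r := by simpa using hy
    have hyq : y ≠ q := by rintro rfl; linarith
    have hc : ContinuousAt (fun z => k * U z + fderiv ℝ U z z) y :=
      ((hU y hyq).continuousAt.const_mul k).add
        (((hU y hyq).fderiv_right (m := 1) (by norm_num)).continuousAt.clm_apply continuousAt_id)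
    have hs : Tendsto (fun z : ℝ × EuclideanSpace ℝ (Fin n) => z.1 • z.2) (𝓝 ((1 : ℝ), y))
        (𝓝 y) := by
      have : ContinuousAt (fun z : ℝ × EuclideanSpace ℝ (Fin n) => z.1 • z.2) ((1 : ℝ), y) := by
        fun_prop
      simpa [ContinuousAt] using this
    exact hs.eventually (hc.eventually (lt_mem_nhds
      (radial_pos_of_kelvin_le hr hrq hn hU hlap hr₁ hr₁q hm0 hm hy')))
  obtain ⟨ε, hε, hΘ⟩ := Metric.eventually_nhds_iff.1 hshell
  obtain ⟨T, hT1, hTε, hTinv, hTr⟩ : ∃ T : ℝ, 1 < T ∧ T < 1 + ε ∧ 1 - ε < T⁻¹ ∧ T * r < ‖q‖ := by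
    have e1 : ∀ᶠ T in 𝓝 (1 : ℝ), T < 1 + ε := gt_mem_nhds (by linarith)
    have e2 : ∀ᶠ T in 𝓝 (1 : ℝ), 1 - ε < T⁻¹ :=
      (continuousAt_inv₀ one_ne_zero).eventually (lt_mem_nhds (by simpa using hε))
    have e3 : ∀ᶠ T in 𝓝 (1 : ℝ), T * r < ‖q‖ := by
      have : ContinuousAt (fun T : ℝ => T * r) 1 := by fun_prop
      exact this.eventually (gt_mem_nhds (by simpa using hrq))
    have := ((e1.and (e2.and e3)).filter_mono (nhdsWithin_le_nhds (s := Set.Ioi 1))).and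
      self_mem_nhdsWithin
    obtain ⟨T, ⟨h1, h2, h3⟩, h4⟩ := this.exists
    exact ⟨T, h4, h1, h2, h3⟩
  have hT0 : 0 < T := by linarith
  set r₂ := T * r with hr₂
  have hrr₂ : r < r₂ := by nlinarith
  have hr₂0 : 0 < r₂ := hr.trans hrr₂
  obtain ⟨m₂, hm₂0, hm₂⟩ := hmin r₂ hrr₂ hTr
  have hfar := le_of_superharmonic_exterior hn hr₂0 hTr hm₂0.le
    (f := fun y => U y - kelvin r U y) (q := q)
    (fun y hy hyq => contDiffAt_sub_kelvin hU hr hrq (hrr₂.le.trans hy) hyq)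
    (fun y hy hyq => hlap y (hrr₂.trans hy) hyq)
    (fun y hy hyq => sub_nonneg.2 (hD y (hrr₂.le.trans hy) hyq)) hm₂
  have hunif : ∀ᶠ r' in 𝓝 r, ∀ x ∈ Metric.closedBall (0 : EuclideanSpace ℝ (Fin n)) r₂⁻¹,
      (r' ^ 2) ^ k * U (r' ^ 2 • x) - (r ^ 2) ^ k * U (r ^ 2 • x) < m₂ * (r₂ ^ 2) ^ k := by
    refine (isCompact_closedBall _ _).eventually_forall_of_forall_eventually fun x hx => ?_
    have hx' : ‖x‖ ≤ r₂⁻¹ := by simpa using hx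
    have hxq : r ^ 2 • x ≠ q := by
      intro h
      have : ‖r ^ 2 • x‖ ≤ r := by
        rw [norm_smul, Real.norm_of_nonneg (by positivity)]
        calc r ^ 2 * ‖x‖ ≤ r ^ 2 * r₂⁻¹ := by gcongr
          _ ≤ r ^ 2 * r⁻¹ := by gcongr
          _ = r := by field_simp
      rw [h] at this
      linarith
    have hc := (hU _ hxq).continuousAt
    have hc1 : ContinuousAt (fun z : ℝ × EuclideanSpace ℝ (Fin n) => U (z.1 ^ 2 • z.2)) (r, x) :=
      ContinuousAt.comp (g := U) (f := fun z : ℝ × EuclideanSpace ℝ (Fin n) => z.1 ^ 2 • z.2)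
        hc (by fun_prop)
    have hc2 : ContinuousAt (fun z : ℝ × EuclideanSpace ℝ (Fin n) => U (r ^ 2 • z.2)) (r, x) :=
      ContinuousAt.comp (g := U) (f := fun z : ℝ × EuclideanSpace ℝ (Fin n) => r ^ 2 • z.2)
        hc (by fun_prop)
    have hc3 : ContinuousAt (fun z : ℝ × EuclideanSpace ℝ (Fin n) => (z.1 ^ 2) ^ k) (r, x) :=
      ContinuousAt.rpow_const (by fun_prop) (Or.inr hkp.le)
    have hc4 := (hc3.mul hc1).sub (hc2.const_mul ((r ^ 2) ^ k))
    have h0 : (r ^ 2) ^ k * U (r ^ 2 • x) - (r ^ 2) ^ k * U (r ^ 2 • x) < m₂ * (r₂ ^ 2) ^ k := by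
      rw [sub_self]; positivity
    exact hc4.eventually (gt_mem_nhds h0)
  filter_upwards [hunif.filter_mono nhdsWithin_le_nhds, self_mem_nhdsWithin] with r' hr' hrr' y hy hyq
  have hrr' : r < r' := hrr'
  have hr'0 : 0 < r' := hr.trans hrr'
  have hy0 : 0 < ‖y‖ := hr'0.trans_le hy
  rcases le_or_gt ‖y‖ r₂ with h | h
  · refine kelvin_le_of_ray hr'0 hy fun t ht1 ht2 => ?_
    have ht0 : 0 < t := lt_of_lt_of_le (by positivity) ht1
    have hy1 : (r / ‖y‖) • y ∈ Metric.sphere (0 : EuclideanSpace ℝ (Fin n)) r := by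
      simp only [mem_sphere_iff_norm, sub_zero, norm_smul]
      rw [Real.norm_of_nonneg (by positivity)]
      field_simp
    have hs1 : t * ‖y‖ / r ≤ T := by
      rw [div_le_iff₀ hr]; nlinarith
    have hs2 : T⁻¹ ≤ t * ‖y‖ / r := by
      rw [le_div_iff₀ hr, inv_mul_le_iff₀ hT0]
      rw [div_le_iff₀ (by positivity)] at ht1
      have h5 : r * ‖y‖ ≤ T * (t * ‖y‖) * ‖y‖ → r ≤ T * (t * ‖y‖) := fun h =>
        le_of_mul_le_mul_right h hy0
      apply h5
      have h6 : r' ^ 2 * T ≤ t * ‖y‖ ^ 2 * T := by gcongr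
      have h7 : r * ‖y‖ ≤ r * r₂ := by gcongr
      have h8 : r * r ≤ r' ^ 2 := by nlinarith
      have h9 : r * r * T ≤ r' ^ 2 * T := by gcongr
      calc r * ‖y‖ ≤ r * r * T := by rw [hr₂] at h7; linarith
        _ ≤ t * ‖y‖ ^ 2 * T := h9.trans h6
        _ = _ := by ring
    have hmem : dist (t * ‖y‖ / r) 1 < ε := by
      rw [Real.dist_eq, abs_lt]
      constructor <;> linarith
    have hres := hΘ hmem _ hy1
    have he : (t * ‖y‖ / r) • (r / ‖y‖) • y = t • y := by
      rw [smul_smul]; congr 1; field_simp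
    rw [he] at hres
    refine ⟨(hU _ ?_).differentiableAt (by simp), hres.le⟩
    intro h'
    have : ‖t • y‖ ≤ r₂ := by
      rw [norm_smul, Real.norm_of_nonneg ht0.le]; nlinarith
    rw [h'] at this
    linarith
  · have h1 := hfar y h.le hyq
    have hx : (‖y‖ ^ 2)⁻¹ • y ∈ Metric.closedBall (0 : EuclideanSpace ℝ (Fin n)) r₂⁻¹ := by
      simp only [Metric.mem_closedBall, dist_zero_right, norm_smul]
      rw [Real.norm_of_nonneg (by positivity)]
      have : (‖y‖ ^ 2)⁻¹ * ‖y‖ = ‖y‖⁻¹ := by field_simp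
      rw [this]
      exact inv_anti₀ hr₂0 h.le
    have h2 := hr' _ hx
    have hker : ∀ s : ℝ, 0 < s →
        kelvin s U y = ((s ^ 2) ^ k * U (s ^ 2 • (‖y‖ ^ 2)⁻¹ • y)) / (‖y‖ ^ 2) ^ k := by
      intro s hs
      rw [kelvin, Real.div_rpow (by positivity) (by positivity), smul_smul, ← div_eq_mul_inv]
      ring
    have hyk : 0 < (‖y‖ ^ 2) ^ k := by positivity
    have h3 : kelvin r' U y - kelvin r U y ≤ m₂ * (r₂ ^ 2 / ‖y‖ ^ 2) ^ k := by
      rw [hker r' hr'0, hker r hr, ← sub_div, Real.div_rpow (by positivity) (by positivity),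
        ← mul_div_assoc]
      gcongr
    linarith

end MovingSpheres

/-- The nonlinearity of the system. -/
def coupling (p ν α β s t : ℝ) : ℝ := s ^ (p - 1) + ν * α * s ^ (α - 1) * t ^ β

section Coupling

variable {p ν α β : ℝ}

lemma coupling_pos (hν : 0 < ν) (hα : 1 < α) {s t : ℝ} (hs : 0 < s) (ht : 0 < t) :
    0 < coupling p ν α β s t := by
  unfold coupling; positivity

lemma coupling_mono (hν : 0 < ν) (hα : 1 < α) (hβ : 1 < β) (hαβ : α + β = p) {s t s' t' : ℝ}
    (hs : 0 < s) (ht : 0 < t) (hss : s ≤ s') (htt : t ≤ t') :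
    coupling p ν α β s t ≤ coupling p ν α β s' t' := by
  have hs' : 0 < s' := hs.trans_le hss
  unfold coupling
  have h1 : s ^ (p - 1) ≤ s' ^ (p - 1) := Real.rpow_le_rpow hs.le hss (by linarith)
  have h2 : s ^ (α - 1) ≤ s' ^ (α - 1) := Real.rpow_le_rpow hs.le hss (by linarith)
  have h3 : t ^ β ≤ t' ^ β := Real.rpow_le_rpow ht.le htt (by linarith)
  gcongr

lemma coupling_smul (hαβ : α + β = p) {c s t : ℝ} (hc : 0 < c) (hs : 0 < s) (ht : 0 < t) :
    coupling p ν α β (c * s) (c * t) = c ^ (p - 1) * coupling p ν α β s t := by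
  unfold coupling
  rw [Real.mul_rpow hc.le hs.le, Real.mul_rpow hc.le hs.le, Real.mul_rpow hc.le ht.le,
    show p - 1 = (α - 1) + β by linarith, Real.rpow_add hc]
  ring

end Coupling

section Symmetry

variable {n : ℕ}

/-- `U` is a positive solution of one of the two equations of the system with the Hardy term
`γ |y - q|⁻² U`, in the field of the second component `V`. -/
structure IsSingularSolution (γ σ p ν α β : ℝ) (q : EuclideanSpace ℝ (Fin n))
    (U V : EuclideanSpace ℝ (Fin n) → ℝ) : Prop where
  contDiffAt : ∀ y, y ≠ q → ContDiffAt ℝ 2 U y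
  pos : ∀ y, y ≠ q → 0 < U y
  lapl_eq : ∀ y, y ≠ q → lapl U y =
    -(γ * (1 / ‖y - q‖) ^ 2 * U y + (1 / ‖y - q‖) ^ σ * coupling p ν α β (U y) (V y))

variable {γ σ p ν α β : ℝ} {q : EuclideanSpace ℝ (Fin n)} {U V : EuclideanSpace ℝ (Fin n) → ℝ}

lemma IsSingularSolution.lapl_neg (hU : IsSingularSolution γ σ p ν α β q U V)
    (hV : IsSingularSolution γ σ p ν β α q V U) (hγ : 0 ≤ γ) (hν : 0 < ν) (hα : 1 < α)
    {y : EuclideanSpace ℝ (Fin n)} (hy : y ≠ q) : lapl U y < 0 := by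
  have h1 := norm_pos_iff.2 (sub_ne_zero.2 hy)
  have h2 := hU.pos y hy
  have h3 := coupling_pos (p := p) (β := β) hν hα h2 (hV.pos y hy)
  rw [hU.lapl_eq y hy, neg_lt_zero]
  positivity

lemma norm_sub_mul_lt {r : ℝ} (hr : 0 < r) (hrq : r < ‖q‖) {y : EuclideanSpace ℝ (Fin n)}
    (hy : r < ‖y‖) : r ^ 2 / ‖y‖ ^ 2 * ‖y - q‖ < ‖(r ^ 2 / ‖y‖ ^ 2) • y - q‖ := by
  have hy0 : 0 < ‖y‖ := hr.trans hy
  have hq0 : 0 < ‖q‖ := hr.trans hrq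
  set s := r / ‖y‖ with hs
  have hs0 : 0 < s := by positivity
  have hs1 : s < 1 := by rw [hs, div_lt_one hy0]; exact hy
  have hτ : r ^ 2 / ‖y‖ ^ 2 = s ^ 2 := by rw [hs, div_pow]
  have hsy : s * ‖y‖ = r := by rw [hs]; field_simp
  rw [hτ]
  refine lt_of_pow_lt_pow_left₀ 2 (norm_nonneg _) ?_
  rw [mul_pow, norm_sub_sq_real, norm_sub_sq_real, norm_smul, real_inner_smul_left,
    Real.norm_of_nonneg (by positivity)]
  have hc := real_inner_le_norm y q
  have h1 : s ^ 2 * inner ℝ y q ≤ s * r * ‖q‖ := by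
    calc s ^ 2 * inner ℝ y q ≤ s ^ 2 * (‖y‖ * ‖q‖) := by gcongr
      _ = s * (s * ‖y‖) * ‖q‖ := by ring
      _ = _ := by rw [hsy]
  have h2 : s * r * ‖q‖ < s * ‖q‖ * ‖q‖ := by gcongr
  have h3 : 0 ≤ (1 - s) ^ 2 * (‖q‖ * ‖q‖) := by positivity
  have h4 : 2 * (s ^ 2 * inner ℝ y q) < (1 + s ^ 2) * ‖q‖ ^ 2 := by nlinarith
  have h5 : 0 < 1 - s ^ 2 := by nlinarith
  nlinarith [mul_lt_mul_of_pos_left h4 h5]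

lemma lapl_sub_kelvin_neg (hU : IsSingularSolution γ σ p ν α β q U V)
    (hV : IsSingularSolution γ σ p ν β α q V U) (hγ : 0 ≤ γ) (hσ : 0 ≤ σ) (hγσ : 0 < γ ∨ 0 < σ)
    (hν : 0 < ν) (hα : 1 < α) (hβ : 1 < β) (hαβ : α + β = p)
    (hσp : (n : ℝ) + 2 - (n - 2) * (p - 1) = 2 * σ) {r : ℝ} (hr : 0 < r) (hrq : r < ‖q‖)
    {y : EuclideanSpace ℝ (Fin n)} (hy : r < ‖y‖) (hyq : y ≠ q) (hDU : kelvin r U y ≤ U y)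
    (hDV : kelvin r V y ≤ V y) : lapl (fun y => U y - kelvin r U y) y < 0 := by
  have hy0 : 0 < ‖y‖ := hr.trans hy
  have hz := inversion_ne hr hrq hy.le
  have hlt := norm_sub_mul_lt hr hrq hy
  rw [lapl_sub (hU.contDiffAt y hyq)
    (contDiffAt_kelvin hr (norm_pos_iff.1 hy0) (hU.contDiffAt _ hz)),
    lapl_kelvin hr (norm_pos_iff.1 hy0) (hU.contDiffAt _ hz), hU.lapl_eq y hyq, hU.lapl_eq _ hz]
  unfold kelvin at hDU hDV
  have hτ0 : 0 < r ^ 2 / ‖y‖ ^ 2 := by positivity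
  set τ := r ^ 2 / ‖y‖ ^ 2 with hτ
  set k := ((n : ℝ) - 2) / 2 with hk
  have hUz := hU.pos _ hz
  have hVz := hV.pos _ hz
  have hA : 0 < ‖y - q‖ := norm_pos_iff.2 (sub_ne_zero.2 hyq)
  have hB : 0 < ‖τ • y - q‖ := norm_pos_iff.2 (sub_ne_zero.2 hz)
  set A := ‖y - q‖
  set B := ‖τ • y - q‖
  have hAB : τ / B < 1 / A := by rw [div_lt_div_iff₀ hB hA]; linarith
  have hτk : 0 < τ ^ k := by positivity
  have hP : 0 < τ ^ k * U (τ • y) := by positivity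
  have hQ : 0 < τ ^ k * V (τ • y) := by positivity
  have hF : τ ^ k * τ ^ 2 * ((1 / B) ^ σ * coupling p ν α β (U (τ • y)) (V (τ • y)))
      = (τ / B) ^ σ * coupling p ν α β (τ ^ k * U (τ • y)) (τ ^ k * V (τ • y)) := by
    rw [coupling_smul hαβ hτk hUz hVz, div_eq_mul_one_div τ B,
      Real.mul_rpow hτ0.le (by positivity), ← Real.rpow_mul hτ0.le]
    have : τ ^ k * τ ^ 2 = τ ^ σ * τ ^ (k * (p - 1)) := by
      rw [← Real.rpow_natCast τ 2, ← Real.rpow_add hτ0, ← Real.rpow_add hτ0]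
      congr 1
      push_cast
      rw [hk]
      linarith
    rw [this]; ring
  have hFle := coupling_mono hν hα hβ hαβ hP hQ hDU hDV
  have hFpos := coupling_pos (p := p) (β := β) hν hα hP hQ
  set F₁ := coupling p ν α β (τ ^ k * U (τ • y)) (τ ^ k * V (τ • y))
  set F₂ := coupling p ν α β (U y) (V y)
  have hτB : 0 < τ / B := by positivity
  have h1 : γ * (τ / B) ^ 2 * (τ ^ k * U (τ • y)) ≤ γ * (1 / A) ^ 2 * U y := by gcongr
  have h2 : (τ / B) ^ σ * F₁ ≤ (1 / A) ^ σ * F₂ := by gcongr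
  have h3 : τ ^ k * τ ^ 2 * (γ * (1 / B) ^ 2 * U (τ • y))
      = γ * (τ / B) ^ 2 * (τ ^ k * U (τ • y)) := by ring
  have hsum : γ * (τ / B) ^ 2 * (τ ^ k * U (τ • y)) + (τ / B) ^ σ * F₁
      < γ * (1 / A) ^ 2 * U y + (1 / A) ^ σ * F₂ := by
    rcases hγσ with h | h
    · refine add_lt_add_of_lt_of_le ?_ h2
      have : γ * (τ / B) ^ 2 < γ * (1 / A) ^ 2 := by gcongr
      calc γ * (τ / B) ^ 2 * (τ ^ k * U (τ • y)) < γ * (1 / A) ^ 2 * (τ ^ k * U (τ • y)) := by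
            gcongr
        _ ≤ _ := by gcongr
    · refine add_lt_add_of_le_of_lt h1 ?_
      have : (τ / B) ^ σ < (1 / A) ^ σ := Real.rpow_lt_rpow hτB.le hAB h
      calc (τ / B) ^ σ * F₁ < (1 / A) ^ σ * F₁ := by gcongr
        _ ≤ _ := by gcongr
  rw [mul_neg, mul_add, h3, hF]
  linarith

lemma continuousAt_kelvin_radius (hU : ∀ y, y ≠ q → ContDiffAt ℝ 2 U y) {r : ℝ} (hr : 0 < r)
    (hrq : r < ‖q‖) {y : EuclideanSpace ℝ (Fin n)} (hy : r ≤ ‖y‖) :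
    ContinuousAt (fun ρ => kelvin ρ U y) r := by
  have hy0 : 0 < ‖y‖ := hr.trans_le hy
  have h1 : ContinuousAt (fun ρ : ℝ => ρ ^ 2 / ‖y‖ ^ 2) r := by fun_prop
  refine (h1.rpow_const (Or.inl (by positivity))).mul ?_
  exact ContinuousAt.comp (g := U) (f := fun ρ : ℝ => (ρ ^ 2 / ‖y‖ ^ 2) • y)
    (hU _ (inversion_ne hr hrq hy)).continuousAt (h1.smul continuousAt_const)

lemma kelvin_le_of_tendsto (hU : ∀ y, y ≠ q → ContDiffAt ℝ 2 U y) {r : ℝ} (hr : 0 < r)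
    (hrq : r < ‖q‖) (hfreq : ∃ᶠ ρ in 𝓝 r, ∀ y, ρ ≤ ‖y‖ → y ≠ q → kelvin ρ U y ≤ U y)
    {y : EuclideanSpace ℝ (Fin n)} (hy : r ≤ ‖y‖) (hyq : y ≠ q) : kelvin r U y ≤ U y := by
  rcases hy.eq_or_lt with h | h
  · have : ‖y‖ ≠ 0 := by rw [← h]; exact hr.ne'
    simp [kelvin, h, this]
  · by_contra! hlt
    obtain ⟨ρ, h1, h2, h3⟩ := (hfreq.and_eventually
      (((continuousAt_kelvin_radius hU hr hrq hy).eventually (lt_mem_nhds hlt)).and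
        (gt_mem_nhds h))).exists
    exact absurd (h1 y h3.le hyq) (not_le.2 h2)

/-- The method of moving spheres: every sphere not enclosing the singular point is admissible. -/
lemma kelvin_le_of_isSingularSolution (hn : 3 ≤ n) (hU : IsSingularSolution γ σ p ν α β q U V)
    (hV : IsSingularSolution γ σ p ν β α q V U) (hγ : 0 ≤ γ) (hσ : 0 ≤ σ) (hγσ : 0 < γ ∨ 0 < σ)
    (hν : 0 < ν) (hα : 1 < α) (hβ : 1 < β) (hαβ : α + β = p)
    (hσp : (n : ℝ) + 2 - (n - 2) * (p - 1) = 2 * σ) {r : ℝ} (hr : 0 < r) (hrq : r < ‖q‖)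
    {y : EuclideanSpace ℝ (Fin n)} (hy : r ≤ ‖y‖) (hyq : y ≠ q) : kelvin r U y ≤ U y := by
  have hq : q ≠ 0 := norm_pos_iff.1 (hr.trans hrq)
  have hαβ' : β + α = p := by linarith
  set S : Set ℝ := {ρ | (∀ y, ρ ≤ ‖y‖ → y ≠ q → kelvin ρ U y ≤ U y) ∧
    (∀ y, ρ ≤ ‖y‖ → y ≠ q → kelvin ρ V y ≤ V y)} with hS
  obtain ⟨r₀, ⟨h1, h2⟩, h3⟩ := (((eventually_kelvin_le hn hq hU.contDiffAt hU.pos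
    fun y hy => hU.lapl_neg hV hγ hν hα hy).and (eventually_kelvin_le hn hq hV.contDiffAt hV.pos
    fun y hy => hV.lapl_neg hU hγ hν hβ hy)).and (Ioo_mem_nhdsGT hr)).exists
  have hsub : Set.Icc r₀ r ⊆ S := by
    refine IsClosed.Icc_subset_of_forall_mem_nhdsWithin ?_ ⟨h1, h2⟩ ?_
    · refine isClosed_of_closure_subset fun ρ hρ => ?_
      have hI : ρ ∈ Set.Icc r₀ r :=
        closure_minimal Set.inter_subset_right isClosed_Icc hρ
      have hf := mem_closure_iff_frequently.1 hρ
      have hρ0 : 0 < ρ := h3.1.trans_le hI.1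
      have hρq : ρ < ‖q‖ := hI.2.trans_lt hrq
      exact ⟨⟨fun y hy hyq => kelvin_le_of_tendsto hU.contDiffAt hρ0 hρq
          (hf.mono fun ρ h => h.1.1) hy hyq,
        fun y hy hyq => kelvin_le_of_tendsto hV.contDiffAt hρ0 hρq
          (hf.mono fun ρ h => h.1.2) hy hyq⟩, hI⟩
    · rintro ρ ⟨⟨hρU, hρV⟩, hI⟩
      have hρ0 : 0 < ρ := h3.1.trans_le hI.1
      have hρq : ρ < ‖q‖ := hI.2.trans hrq
      have e1 := eventually_kelvin_le_of_kelvin_le hn hρ0 hρq hU.contDiffAt hρU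
        fun y hy hyq => lapl_sub_kelvin_neg hU hV hγ hσ hγσ hν hα hβ hαβ hσp hρ0 hρq hy hyq
          (hρU y hy.le hyq) (hρV y hy.le hyq)
      have e2 := eventually_kelvin_le_of_kelvin_le hn hρ0 hρq hV.contDiffAt hρV
        fun y hy hyq => lapl_sub_kelvin_neg hV hU hγ hσ hγσ hν hβ hα hαβ' hσp hρ0 hρq hy hyq
          (hρV y hy.le hyq) (hρU y hy.le hyq)
      exact e1.and e2
  exact (hsub ⟨h3.2.le, le_rfl⟩).1 y hy hyq

lemma IsSingularSolution.translate (hU : IsSingularSolution γ σ p ν α β 0 U V)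
    (c : EuclideanSpace ℝ (Fin n)) :
    IsSingularSolution γ σ p ν α β (-c) (fun y => U (y + c)) (fun y => V (y + c)) := by
  have hne : ∀ y, y ≠ -c → y + c ≠ 0 := fun y hy h => hy (eq_neg_of_add_eq_zero_left h)
  refine ⟨fun y hy => ?_, fun y hy => hU.pos _ (hne y hy), fun y hy => ?_⟩
  · exact ContDiffAt.comp (g := U) (f := fun y => y + c) y (hU.contDiffAt _ (hne y hy))
      (contDiffAt_id.add contDiffAt_const)
  · rw [lapl_comp_add_right, hU.lapl_eq _ (hne y hy)]
    simp

lemma reflection_le (hn : 3 ≤ n) (hU : IsSingularSolution γ σ p ν α β 0 U V)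
    (hV : IsSingularSolution γ σ p ν β α 0 V U) (hγ : 0 ≤ γ) (hσ : 0 ≤ σ) (hγσ : 0 < γ ∨ 0 < σ)
    (hν : 0 < ν) (hα : 1 < α) (hβ : 1 < β) (hαβ : α + β = p)
    (hσp : (n : ℝ) + 2 - (n - 2) * (p - 1) = 2 * σ) {y e : EuclideanSpace ℝ (Fin n)}
    (he : ‖e‖ = 1) (hye : inner ℝ y e < 0) : U (y - (2 * inner ℝ y e) • e) ≤ U y := by
  have hy0 : y ≠ 0 := by rintro rfl; simp at hye
  set c := inner ℝ y e with hc
  set k := ((n : ℝ) - 2) / 2 with hk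
  set den : ℝ → ℝ := fun ε => 1 - 2 * ε * c + ε ^ 2 * ‖y‖ ^ 2 with hden
  set τ : ℝ → ℝ := fun ε => (1 - ε ^ 2) / den ε with hτ
  set z : ℝ → EuclideanSpace ℝ (Fin n) := fun ε =>
    τ ε • y + ((-2 * c + ε * ‖y‖ ^ 2 + ε) / den ε) • e with hz
  have hz0 : z 0 = y - (2 * c) • e := by simp [hz, hτ, hden, sub_eq_add_neg]
  have hzne : z 0 ≠ 0 := by
    intro h
    rw [hz0, sub_eq_zero] at h
    have h2 : inner ℝ y e = 2 * c := by
      conv_lhs => rw [h]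
      rw [real_inner_smul_left, real_inner_self_eq_norm_sq, he]; ring
    linarith
  have hdenc : ContinuousAt den 0 := by simp only [hden]; fun_prop
  have hden0 : den 0 ≠ 0 := by simp [hden]
  have hτc : ContinuousAt τ 0 := ContinuousAt.div (by fun_prop) hdenc hden0
  have hzc : ContinuousAt z 0 := (hτc.smul continuousAt_const).add
    ((ContinuousAt.div (by fun_prop) hdenc hden0).smul continuousAt_const)
  have hcont : ContinuousAt (fun ε => τ ε ^ k * U (z ε)) 0 :=
    (hτc.rpow_const (Or.inl (by simp [hτ, hden]))).mul
      (ContinuousAt.comp (g := U) (f := z) (hU.contDiffAt _ hzne).continuousAt hzc)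
  have hlim : Tendsto (fun ε => τ ε ^ k * U (z ε)) (𝓝[>] 0) (𝓝 (U (y - (2 * c) • e))) := by
    have := hcont.tendsto.mono_left (nhdsWithin_le_nhds (s := Set.Ioi 0))
    rw [hz0] at this
    simpa [hτ, hden] using this
  refine le_of_tendsto hlim ?_
  filter_upwards [Ioo_mem_nhdsGT one_pos] with ε hε
  have hε0 : 0 < ε := hε.1
  have hdenp : 0 < den ε := by
    have : 0 < ε * -c := mul_pos hε0 (by linarith)
    simp only [hden]; nlinarith [sq_nonneg (ε * ‖y‖)]
  have hr2 : 0 < (1 - ε ^ 2) / ε ^ 2 := by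
    have : 0 < 1 - ε ^ 2 := by nlinarith [hε.2]
    positivity
  set r := √((1 - ε ^ 2) / ε ^ 2) with hr
  have hrsq : r ^ 2 = (1 - ε ^ 2) / ε ^ 2 := Real.sq_sqrt hr2.le
  have hr0 : 0 < r := Real.sqrt_pos.2 hr2
  set x₀ : EuclideanSpace ℝ (Fin n) := ε⁻¹ • e with hx₀
  have hx₀n : ‖x₀‖ = ε⁻¹ := by
    rw [hx₀, norm_smul, he, mul_one, Real.norm_of_nonneg (by positivity)]
  have hnorm : ‖y - x₀‖ ^ 2 = den ε / ε ^ 2 := by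
    rw [norm_sub_sq_real, hx₀n, hx₀, inner_smul_right, ← hc]
    simp only [hden]
    field_simp
    ring
  have hrx : r < ‖-x₀‖ := by
    refine lt_of_pow_lt_pow_left₀ 2 (norm_nonneg _) ?_
    rw [norm_neg, hx₀n, hrsq, inv_pow, div_lt_iff₀ (by positivity)]
    field_simp
    nlinarith
  have hry : r ≤ ‖y - x₀‖ := by
    refine le_of_sq_le_sq ?_ (norm_nonneg _)
    rw [hnorm, hrsq]
    gcongr
    have : 0 < ε * -c := mul_pos hε0 (by linarith)
    simp only [hden]; nlinarith [sq_nonneg (ε * ‖y‖)]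
  have hmain := kelvin_le_of_isSingularSolution hn (hU.translate x₀) (hV.translate x₀) hγ hσ hγσ
    hν hα hβ hαβ hσp hr0 hrx hry (by
      intro h; apply hy0; simpa using h)
  have hτe : r ^ 2 / ‖y - x₀‖ ^ 2 = τ ε := by
    rw [hnorm, hrsq]; simp only [hτ]; field_simp
  rw [kelvin, hτe, sub_add_cancel] at hmain
  have hze : τ ε • (y - x₀) + x₀ = z ε := by
    simp only [hz, hx₀, smul_sub, smul_smul]
    have : (-2 * c + ε * ‖y‖ ^ 2 + ε) / den ε = ε⁻¹ - τ ε * ε⁻¹ := by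
      simp only [hτ]
      field_simp
      simp only [hden]
      ring
    rw [this, sub_smul]
    abel
  rwa [hze] at hmain

/-- Positive solutions with a singularity at the origin are radially symmetric. -/
lemma IsSingularSolution.radial (hn : 3 ≤ n) (hU : IsSingularSolution γ σ p ν α β 0 U V)
    (hV : IsSingularSolution γ σ p ν β α 0 V U) (hγ : 0 ≤ γ) (hσ : 0 ≤ σ) (hγσ : 0 < γ ∨ 0 < σ)
    (hν : 0 < ν) (hα : 1 < α) (hβ : 1 < β) (hαβ : α + β = p)
    (hσp : (n : ℝ) + 2 - (n - 2) * (p - 1) = 2 * σ) {x y : EuclideanSpace ℝ (Fin n)}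
    (hxy : ‖x‖ = ‖y‖) : U x = U y := by
  have key : ∀ x y : EuclideanSpace ℝ (Fin n), ‖x‖ = ‖y‖ → x ≠ y → U x ≤ U y := by
    intro x y hxy hne
    have hd : 0 < ‖x - y‖ := norm_pos_iff.2 (sub_ne_zero.2 hne)
    set e := ‖x - y‖⁻¹ • (x - y) with he
    have he1 : ‖e‖ = 1 := by
      rw [he, norm_smul, norm_inv, norm_norm, inv_mul_cancel₀ hd.ne']
    have h2 : ‖x - y‖ ^ 2 = 2 * (‖y‖ ^ 2 - inner ℝ x y) := by
      rw [norm_sub_sq_real, hxy]; ring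
    have hin : inner ℝ y e = -‖x - y‖ / 2 := by
      rw [he, inner_smul_right, inner_sub_right, real_inner_self_eq_norm_sq, real_inner_comm]
      field_simp
      linarith
    have := reflection_le hn hU hV hγ hσ hγσ hν hα hβ hαβ hσp he1 (by rw [hin]; linarith)
    have hx : y - (2 * inner ℝ y e) • e = x := by
      rw [hin, he, smul_smul]
      have : 2 * (-‖x - y‖ / 2) * ‖x - y‖⁻¹ = -1 := by field_simp
      rw [this]; simp
    rwa [hx] at this
  rcases eq_or_ne x y with rfl | hne
  · rfl
  · exact le_antisymm (key x y hxy hne) (key y x hxy.symm hne.symm)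

end Symmetry

section Reduction

variable {n : ℕ}

lemma HasD2.hasDerivAt_deriv {V : Type*} [NormedAddCommGroup V] [NormedSpace ℝ V] {g : ℝ → V}
    {s : ℝ} {a b : V} (h : HasD2 g s a b) : HasDerivAt (deriv g) b s := by
  obtain ⟨g', h1, h2, h3⟩ := h
  exact h3.congr_of_eventuallyEq (h1.mono fun t ht => ht.deriv)

lemma ContDiffAt.hasD2 {f : ℝ → ℝ} {s : ℝ} (hf : ContDiffAt ℝ 2 f s) :
    HasD2 f s (deriv f s) (deriv (deriv f) s) := by
  have h := HasD2.comp_curve (f := f) (by simpa using hf) (HasD2.line (0 : ℝ) 1 s)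
  simp only [smul_eq_mul, mul_one, zero_add] at h
  exact h.congr_val h.hasDerivAt.deriv.symm h.deriv_deriv.symm

lemma lapl_congr {f g : EuclideanSpace ℝ (Fin n) → ℝ} {x : EuclideanSpace ℝ (Fin n)}
    (h : f =ᶠ[𝓝 x] g) : lapl f x = lapl g x := by
  refine Finset.sum_congr rfl fun i _ => ?_
  have h2 : (fun y => fderiv ℝ f y (EuclideanSpace.single i (1 : ℝ))) =ᶠ[𝓝 x]
      fun y => fderiv ℝ g y (EuclideanSpace.single i (1 : ℝ)) := by
    filter_upwards [h.fderiv (𝕜 := ℝ)] with y hy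
    rw [hy]
  rw [h2.fderiv_eq]

lemma inner_gradient (u : EuclideanSpace ℝ (Fin n) → ℝ) (x y : EuclideanSpace ℝ (Fin n)) :
    inner ℝ y (gradient u x) = fderiv ℝ u x y := by
  rw [real_inner_comm, gradient, InnerProductSpace.toDual_symm_apply]

lemma norm_gradient (u : EuclideanSpace ℝ (Fin n) → ℝ) (x : EuclideanSpace ℝ (Fin n)) :
    ‖gradient u x‖ = ‖fderiv ℝ u x‖ := by
  rw [gradient, LinearIsometryEquiv.norm_map]

lemma lapl_rpow_norm_mul {u : EuclideanSpace ℝ (Fin n) → ℝ} {x : EuclideanSpace ℝ (Fin n)}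
    (hu : ContDiffAt ℝ 2 u x) (hx : x ≠ 0) (a : ℝ) :
    lapl (fun y => ‖y‖ ^ (-a) * u y) x = ‖x‖ ^ (-a) *
      (lapl u x - 2 * a * fderiv ℝ u x x / ‖x‖ ^ 2 - a * (n - 2 - a) * (1 / ‖x‖) ^ 2 * u x) := by
  have hx0 := norm_pos_iff.2 hx
  have hR : 0 < ‖x‖ ^ 2 := by positivity
  have hpow : ∀ y : EuclideanSpace ℝ (Fin n), ‖y‖ ^ (-a) = (‖y‖ ^ 2) ^ (-a / 2) := by
    intro y
    rw [← Real.rpow_natCast, ← Real.rpow_mul (norm_nonneg y)]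
    congr 1; push_cast; ring
  simp only [hpow]
  have hφc : ContDiffAt ℝ 2 (fun y : EuclideanSpace ℝ (Fin n) => (‖y‖ ^ 2) ^ (-a / 2)) x :=
    contDiffAt_norm_sq_comp (ψ := fun t => t ^ (-a / 2)) (Real.contDiffAt_rpow_const_of_ne hR.ne')
  have hφ : ∀ i : Fin n, _ := fun i => HasD2.comp (f := fun t : ℝ => t ^ (-a / 2)) (s := 0)
    (by simpa using HasD2.rpow hR (-a / 2)) (hasD2_norm_sq_line x i)
  rw [lapl_eq_of_hasD2 (hφc.mul hu) fun i => (hφ i).mul (hu.hasD2_line _), lapl_eq_sum hu]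
  simp only [zero_smul, add_zero]
  have e1 : (‖x‖ ^ 2) ^ (-a / 2 - 1) = (‖x‖ ^ 2) ^ (-a / 2) / ‖x‖ ^ 2 :=
    Real.rpow_sub_one hR.ne' _
  have e2 : (‖x‖ ^ 2) ^ (-a / 2 - 1 - 1) = (‖x‖ ^ 2) ^ (-a / 2) / ‖x‖ ^ 2 / ‖x‖ ^ 2 := by
    rw [Real.rpow_sub_one hR.ne', e1]
  rw [e2, e1]
  set φ := (‖x‖ ^ 2) ^ (-a / 2)
  have s1 : ∑ i, (x i) ^ 2 = ‖x‖ ^ 2 := (EuclideanSpace.real_norm_sq_eq x).symm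
  have s2 : ∑ i, x i * fderiv ℝ u x (EuclideanSpace.single i (1 : ℝ)) = fderiv ℝ u x x := by
    have hsum : x = ∑ i, x i • EuclideanSpace.single i (1 : ℝ) := by
      have := (EuclideanSpace.basisFun (Fin n) ℝ).sum_repr x
      simpa using this.symm
    conv_rhs => arg 2; rw [hsum]
    simp only [map_sum, map_smul, smul_eq_mul]
  set R := ‖x‖ ^ 2 with hRdef
  have hR' : (1 / ‖x‖) ^ 2 = 1 / R := by rw [hRdef, one_div_pow]
  rw [hR']
  have expand : ∀ i : Fin n, _ = φ * fderiv ℝ (fderiv ℝ u) x (EuclideanSpace.single i (1 : ℝ))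
        (EuclideanSpace.single i (1 : ℝ))
      + (-2 * a * φ / R) * (x i * fderiv ℝ u x (EuclideanSpace.single i (1 : ℝ)))
      + (4 * (-a / 2) * (-a / 2 - 1) * φ / R ^ 2 * u x) * (x i) ^ 2
      + (2 * (-a / 2) * φ / R * u x) := fun i => rfl
  rw [Finset.sum_congr rfl fun i _ => Eq.trans (by field_simp; ring) (expand i).symm]
  simp only [← Finset.mul_sum, Finset.sum_add_distrib, s1, s2, Finset.sum_const,
    Finset.card_univ, Fintype.card_fin, nsmul_eq_mul]
  field_simp
  ring

variable {a b p ν α β lam : ℝ} {u v : EuclideanSpace ℝ (Fin n) → ℝ}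

lemma lapl_eq_of_wdiv {x : EuclideanSpace ℝ (Fin n)} (hx : x ≠ 0)
    (h : -(wdiv a u x) = ‖x‖ ^ (-(b * p)) * coupling p ν α β (u x) (v x)) :
    lapl u x - 2 * a * fderiv ℝ u x x / ‖x‖ ^ 2
      = -(‖x‖ ^ (2 * a - b * p) * coupling p ν α β (u x) (v x)) := by
  have hx0 := norm_pos_iff.2 hx
  rw [wdiv, inner_gradient] at h
  have h1 : ‖x‖ ^ (2 * a) * ‖x‖ ^ (-(2 * a)) = 1 := by
    rw [← Real.rpow_add hx0]; simp
  have h2 : ‖x‖ ^ (2 * a - b * p) = ‖x‖ ^ (2 * a) * ‖x‖ ^ (-(b * p)) := by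
    rw [← Real.rpow_add hx0, sub_eq_add_neg]
  rw [h2]
  linear_combination (-‖x‖ ^ (2 * a)) * h
    - (lapl u x - 2 * a * fderiv ℝ u x x / ‖x‖ ^ 2) * h1

lemma isSingularSolution_of_wdiv (hαβ : α + β = p) (hu : ContDiffOn ℝ 2 u {0}ᶜ)
    (hupos : ∀ x, x ≠ 0 → 0 < u x) (hvpos : ∀ x, x ≠ 0 → 0 < v x)
    (hueq : ∀ x, x ≠ 0 →
      -(wdiv a u x) = ‖x‖ ^ (-(b * p)) * coupling p ν α β (u x) (v x)) :
    IsSingularSolution (a * (n - 2 - a)) ((b - a) * p) p ν α β 0 (fun y => ‖y‖ ^ (-a) * u y)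
      (fun y => ‖y‖ ^ (-a) * v y) := by
  have huc : ∀ y, y ≠ 0 → ContDiffAt ℝ 2 u y := fun y hy =>
    hu.contDiffAt (isOpen_compl_singleton.mem_nhds hy)
  refine ⟨fun y hy => ?_, fun y hy => ?_, fun y hy => ?_⟩
  · exact ((contDiffAt_norm ℝ hy).rpow_const_of_ne (norm_ne_zero_iff.2 hy)).mul (huc y hy)
  · have := hupos y hy
    have := norm_pos_iff.2 hy
    positivity
  · have hy0 := norm_pos_iff.2 hy
    have hφ : 0 < ‖y‖ ^ (-a) := by positivity
    rw [lapl_rpow_norm_mul (huc y hy) hy, lapl_eq_of_wdiv hy (hueq y hy), sub_zero,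
      coupling_smul hαβ hφ (hupos y hy) (hvpos y hy)]
    have : (1 / ‖y‖) ^ ((b - a) * p) * (‖y‖ ^ (-a)) ^ (p - 1)
        = ‖y‖ ^ (-a) * ‖y‖ ^ (2 * a - b * p) := by
      rw [one_div, Real.inv_rpow hy0.le, ← Real.rpow_neg hy0.le, ← Real.rpow_mul hy0.le,
        ← Real.rpow_add hy0, ← Real.rpow_add hy0]
      congr 1; ring
    rw [← mul_assoc _ (_ ^ (p - 1)), this]
    ring

lemma hasD2_exp_mul (c t : ℝ) :
    HasD2 (fun t => exp (c * t)) t (c * exp (c * t)) (c ^ 2 * exp (c * t)) := by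
  have h : ∀ t, HasDerivAt (fun t => exp (c * t)) (c * exp (c * t)) t := fun t => by
    have := ((hasDerivAt_id t).const_mul c).exp
    exact this.congr_deriv (by simp [mul_comm])
  exact ⟨fun t => c * exp (c * t), Eventually.of_forall h, rfl,
    ((h t).const_mul c).congr_deriv (by ring)⟩

/-- The Emden–Fowler transform of a radial function, read along the direction `e`. -/
def emden (lam : ℝ) (e : EuclideanSpace ℝ (Fin n)) (u : EuclideanSpace ℝ (Fin n) → ℝ) (t : ℝ) : ℝ :=
  exp (lam * t) * u (exp t • e)

/-- The profile of a radial function as a function of the squared norm. -/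
def profile (e : EuclideanSpace ℝ (Fin n)) (u : EuclideanSpace ℝ (Fin n) → ℝ) (s : ℝ) : ℝ :=
  u (√s • e)

lemma emden_eq_profile (e : EuclideanSpace ℝ (Fin n)) (t : ℝ) :
    emden lam e u t = exp (lam * t) * profile e u (exp (2 * t)) := by
  rw [emden, profile, two_mul, exp_add, Real.sqrt_mul_self (exp_pos t).le]

section Radial

variable {e : EuclideanSpace ℝ (Fin n)}

lemma contDiffAt_profile (he : ‖e‖ = 1) (hu : ContDiffOn ℝ 2 u {0}ᶜ) {s : ℝ} (hs : 0 < s) :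
    ContDiffAt ℝ 2 (profile e u) s := by
  have hne : √s • e ≠ 0 := by
    rw [← norm_ne_zero_iff, norm_smul, he, mul_one]
    simpa using (Real.sqrt_pos.2 hs).ne'
  exact ContDiffAt.comp (g := u) (f := fun s => √s • e) s
    (hu.contDiffAt (isOpen_compl_singleton.mem_nhds hne))
    ((Real.contDiffAt_sqrt hs.ne').smul contDiffAt_const)

lemma eventuallyEq_profile (he : ‖e‖ = 1) (hrad : ∀ x y, x ≠ 0 → ‖x‖ = ‖y‖ → u x = u y)
    {x : EuclideanSpace ℝ (Fin n)} (hx : x ≠ 0) :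
    u =ᶠ[𝓝 x] fun y => profile e u (‖y‖ ^ 2) := by
  filter_upwards [isOpen_ne.mem_nhds hx] with y hy
  rw [profile, Real.sqrt_sq (norm_nonneg y)]
  exact hrad _ _ hy (by rw [norm_smul, he, norm_norm, mul_one])

lemma hasFDerivAt_radial (he : ‖e‖ = 1) (hu : ContDiffOn ℝ 2 u {0}ᶜ)
    (hrad : ∀ x y, x ≠ 0 → ‖x‖ = ‖y‖ → u x = u y) {x : EuclideanSpace ℝ (Fin n)} (hx : x ≠ 0) :
    HasFDerivAt u (deriv (profile e u) (‖x‖ ^ 2) • (2 • innerSL ℝ x)) x := by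
  have hR : 0 < ‖x‖ ^ 2 := by have := norm_pos_iff.2 hx; positivity
  have h := ((contDiffAt_profile he hu hR).differentiableAt (by simp)).hasDerivAt
  have h2 : HasFDerivAt (fun y => profile e u (‖y‖ ^ 2))
      (deriv (profile e u) (‖x‖ ^ 2) • (2 • innerSL ℝ x)) x :=
    HasDerivAt.comp_hasFDerivAt (h₂ := profile e u) x h (hasStrictFDerivAt_norm_sq x).hasFDerivAt
  exact h2.congr_of_eventuallyEq (eventuallyEq_profile he hrad hx)

lemma hasD2_emden (he : ‖e‖ = 1) (hu : ContDiffOn ℝ 2 u {0}ᶜ)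
    (hrad : ∀ x y, x ≠ 0 → ‖x‖ = ‖y‖ → u x = u y) (hαβ : α + β = p)
    (hupos : ∀ x, x ≠ 0 → 0 < u x) (hvpos : ∀ x, x ≠ 0 → 0 < v x)
    (hlam : 2 * lam = n - 2 - 2 * a) (hlamp : lam * (p - 2) = 2 + 2 * a - b * p)
    (hueq : ∀ x, x ≠ 0 →
      -(wdiv a u x) = ‖x‖ ^ (-(b * p)) * coupling p ν α β (u x) (v x)) (t : ℝ) :
    HasD2 (emden lam e u) t
      (lam * emden lam e u t
        + exp (lam * t) * (2 * exp (2 * t) * deriv (profile e u) (exp (2 * t))))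
      (lam ^ 2 * emden lam e u t - coupling p ν α β (emden lam e u t) (emden lam e v t)) := by
  set x := exp t • e with hxdef
  have hxn : ‖x‖ = exp t := by
    rw [hxdef, norm_smul, he, mul_one, Real.norm_of_nonneg (exp_pos t).le]
  have hx : x ≠ 0 := by rw [← norm_ne_zero_iff, hxn]; exact (exp_pos t).ne'
  have hR : ‖x‖ ^ 2 = exp (2 * t) := by rw [hxn, two_mul, exp_add, sq]
  have hRp : 0 < exp (2 * t) := exp_pos _
  have hψ := (contDiffAt_profile he hu hRp).hasD2
  set A := deriv (profile e u) (exp (2 * t)) with hA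
  set B := deriv (deriv (profile e u)) (exp (2 * t)) with hB
  have hlapl : lapl u x = 4 * exp (2 * t) * B + 2 * n * A := by
    rw [lapl_congr (eventuallyEq_profile he hrad hx), lapl_radial (A := A) (B := B), hR]
    · rw [hR]; exact contDiffAt_profile he hu hRp
    · rw [hR]; exact hψ
  have hfd : fderiv ℝ u x x = 2 * exp (2 * t) * A := by
    rw [(hasFDerivAt_radial he hu hrad hx).fderiv, hR]
    simp [hR]
    ring
  have hode := lapl_eq_of_wdiv hx (hueq x hx)
  rw [hlapl, hfd, hR, hxn, ← Real.exp_mul] at hode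
  have hw : profile e u (exp (2 * t)) = u x := by
    rw [profile, two_mul, exp_add, Real.sqrt_mul_self (exp_pos t).le]
  have hF : exp (lam * t) * (exp (2 * t) * (exp (t * (2 * a - b * p)) *
      coupling p ν α β (u x) (v x)))
      = coupling p ν α β (emden lam e u t) (emden lam e v t) := by
    rw [emden, emden, coupling_smul hαβ (exp_pos _) (hupos x hx) (hvpos x hx), ← Real.exp_mul,
      ← mul_assoc, ← mul_assoc, ← Real.exp_add, ← Real.exp_add]
    congr 2
    linear_combination (-t) * hlamp
  have h := (hasD2_exp_mul lam t).mul (HasD2.comp (f := profile e u) hψ (hasD2_exp_mul 2 t))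
  have hfun : emden lam e u = fun t => exp (lam * t) * profile e u (exp (2 * t)) :=
    funext fun t => emden_eq_profile e t
  rw [hfun]
  refine h.congr_val ?_ ?_
  · ring
  · rw [← hfun, ← hF, hw, show emden lam e u t = exp (lam * t) * u x from rfl]
    have h4 : exp (2 * t) * (4 * exp (2 * t) * B + 2 * n * A - 2 * a * (2 * A))
        = - (exp (2 * t) * (exp (t * (2 * a - b * p)) * coupling p ν α β (u x) (v x))) := by
      rw [← mul_neg, ← hode]
      field_simp
    have h5 : (n : ℝ) = 2 * lam + 2 + 2 * a := by linarith
    rw [h5] at h4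
    linear_combination exp (lam * t) * h4

lemma integrable_emden (hn : 3 ≤ n) (he : ‖e‖ = 1) (hu : ContDiffOn ℝ 2 u {0}ᶜ)
    (hrad : ∀ x y, x ≠ 0 → ‖x‖ = ‖y‖ → u x = u y) (hlam : 2 * lam = n - 2 - 2 * a)
    (hw : ∀ t, deriv (emden lam e u) t = lam * emden lam e u t
        + exp (lam * t) * (2 * exp (2 * t) * deriv (profile e u) (exp (2 * t))))
    (hE : finiteEnergy a u) :
    Integrable fun t => (lam * emden lam e u t - deriv (emden lam e u) t) ^ 2 := by
  have : Nonempty (Fin n) := ⟨⟨0, by omega⟩⟩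
  have : Nontrivial (EuclideanSpace ℝ (Fin n)) := inferInstance
  set g : ℝ → ℝ := fun t => (lam * emden lam e u t - deriv (emden lam e u) t) ^ 2 with hg
  have hgr : ∀ x : EuclideanSpace ℝ (Fin n), x ≠ 0 → ‖x‖ ^ (-(2 * a)) * ‖gradient u x‖ ^ 2
      = ‖x‖ ^ (-(n : ℝ)) * g (log ‖x‖) := by
    intro x hx
    have hx0 := norm_pos_iff.2 hx
    obtain ⟨t, ht⟩ : ∃ t, ‖x‖ = exp t := ⟨log ‖x‖, (Real.exp_log hx0).symm⟩
    have h2 : ‖x‖ ^ 2 = exp (2 * t) := by rw [ht, two_mul, exp_add, sq]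
    rw [norm_gradient, (hasFDerivAt_radial he hu hrad hx).fderiv, h2, norm_smul, ← Nat.cast_smul_eq_nsmul ℝ,
      norm_smul, innerSL_apply_norm]
    simp only [hg]
    rw [ht, Real.log_exp, hw, ← Real.exp_mul, ← Real.exp_mul]
    set A := deriv (profile e u) (exp (2 * t))
    have h3 : exp (t * -(n : ℝ)) * exp (lam * t) ^ 2 * exp (2 * t) ^ 2
        = exp (t * -(2 * a)) * exp t ^ 2 := by
      simp only [← Real.exp_nat_mul, ← Real.exp_add]
      congr 1
      push_cast
      linear_combination t * hlam
    have h4 : ‖A‖ ^ 2 = A ^ 2 := by simp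
    have h5 : ‖((2 : ℕ) : ℝ)‖ = 2 := by simp
    rw [h5, mul_pow, h4]
    linear_combination (-4 * A ^ 2) * h3
  have h1 : Integrable (fun x : EuclideanSpace ℝ (Fin n) => ‖x‖ ^ (-(n : ℝ)) * g (log ‖x‖)) := by
    refine hE.congr ?_
    have : ∀ᵐ x : EuclideanSpace ℝ (Fin n), x ≠ 0 := by
      simp [ae_iff]
    filter_upwards [this] with x hx using hgr x hx
  rw [integrable_fun_norm_addHaar (μ := volume) (f := fun y => y ^ (-(n : ℝ)) * g (log y)),
    finrank_euclideanSpace_fin] at h1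
  have himg : Set.Ioi (0 : ℝ) = exp '' Set.univ := by rw [Set.image_univ, Real.range_exp]
  rw [himg, integrableOn_image_iff_integrableOn_abs_deriv_smul MeasurableSet.univ
    (fun x _ => (Real.hasDerivAt_exp x).hasDerivWithinAt) Real.exp_injective.injOn,
    integrableOn_univ] at h1
  refine h1.congr (Eventually.of_forall fun t => ?_)
  simp only [smul_eq_mul, Real.log_exp, abs_of_pos (exp_pos t)]
  rw [← Real.exp_mul, ← Real.exp_nat_mul, ← mul_assoc, ← mul_assoc, ← Real.exp_add, ← Real.exp_add]
  have : t + ((n - 1 : ℕ) : ℝ) * t + t * -(n : ℝ) = 0 := by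
    rw [Nat.cast_sub (by omega)]; push_cast; ring
  rw [this, Real.exp_zero, one_mul]

end Radial

end Reduction

section Emden

lemma exists_nonpos_of_deriv_le {φ φ' : ℝ → ℝ} (hφ : ∀ t, HasDerivAt φ (φ' t) t) {T c : ℝ}
    (hc : 0 < c) (h : ∀ t, T ≤ t → φ' t ≤ -c) : ∃ t, T ≤ t ∧ φ t ≤ 0 := by
  have hanti : AntitoneOn (fun t => φ t + c * t) (Set.Ici T) := by
    have hd : ∀ t, HasDerivAt (fun t => φ t + c * t) (φ' t + c) t := fun t =>
      ((hφ t).fun_add ((hasDerivAt_id t).const_mul c)).congr_deriv (by simp)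
    refine antitoneOn_of_deriv_nonpos (convex_Ici T)
      (fun t _ => (hd t).continuousAt.continuousWithinAt)
      (fun t _ => (hd t).differentiableAt.differentiableWithinAt) fun t ht => ?_
    rw [interior_Ici] at ht
    rw [(hd t).deriv]
    linarith [h t (le_of_lt ht)]
  have hs : 0 ≤ |φ T| / c := by positivity
  refine ⟨T + |φ T| / c, by linarith, ?_⟩
  have h1 := hanti (Set.mem_Ici.2 le_rfl) (Set.mem_Ici.2 (by linarith)) (by linarith :
    T ≤ T + |φ T| / c)
  have h2 : c * (|φ T| / c) = |φ T| := by field_simp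
  simp only [mul_add] at h1
  linarith [le_abs_self (φ T)]

lemma hasDerivAt_exp_mul_mul {φ : ℝ → ℝ} {φ' c t : ℝ} (h : HasDerivAt φ φ' t) :
    HasDerivAt (fun t => exp (c * t) * φ t) (exp (c * t) * (c * φ t + φ')) t :=
  ((hasD2_exp_mul c t).hasDerivAt.fun_mul h).congr_deriv (by ring)

lemma mul_add_deriv_pos {w w' f : ℝ → ℝ} {lam : ℝ} (hw0 : ∀ t, 0 < w t)
    (hf : ∀ t, 0 < f t) (hw : ∀ t, HasDerivAt w (w' t) t)
    (hw' : ∀ t, HasDerivAt w' (lam ^ 2 * w t - f t) t) (hlam : 0 < lam) (t : ℝ) :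
    0 < lam * w t + w' t := by
  by_contra! hneg
  have hK : ∀ t, HasDerivAt (fun t => exp (-lam * t) * (lam * w t + w' t))
      (-(exp (-lam * t) * f t)) t := fun t =>
    (hasDerivAt_exp_mul_mul (((hw t).const_mul lam).fun_add (hw' t))).congr_deriv (by ring)
  have hanti : StrictAnti fun t => exp (-lam * t) * (lam * w t + w' t) :=
    strictAnti_of_deriv_neg fun t => by
      rw [(hK t).deriv]
      have := mul_pos (exp_pos (-lam * t)) (hf t)
      linarith
  set c := -(exp (-lam * (t + 1)) * (lam * w (t + 1) + w' (t + 1))) with hc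
  have hc0 : 0 < c := by
    have h1 := hanti (by linarith : t < t + 1)
    have h2 : exp (-lam * t) * (lam * w t + w' t) ≤ 0 :=
      mul_nonpos_of_nonneg_of_nonpos (exp_pos _).le hneg
    simp only at h1
    linarith
  have hφ : ∀ t, HasDerivAt (fun t => exp (lam * t) * w t) (exp (lam * t) * (lam * w t + w' t)) t :=
    fun t => hasDerivAt_exp_mul_mul (hw t)
  obtain ⟨s, -, hs⟩ := exists_nonpos_of_deriv_le hφ (T := max (t + 1) 0) hc0 (fun s hs => by
    have h1 := hanti.antitone ((le_max_left _ _).trans hs)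
    have h2 : 1 ≤ exp (2 * lam * s) := by
      apply Real.one_le_exp
      have := (le_max_right _ _).trans hs
      positivity
    have h3 : exp (lam * s) = exp (2 * lam * s) * exp (-lam * s) := by
      rw [← exp_add]; congr 1; ring
    rw [h3, mul_assoc]
    nlinarith)
  exact absurd hs (not_le.2 (mul_pos (exp_pos _) (hw0 s)))

lemma mul_sub_deriv_pos {w w' f : ℝ → ℝ} {lam : ℝ} (hw0 : ∀ t, 0 < w t)
    (hf : ∀ t, 0 < f t) (hw : ∀ t, HasDerivAt w (w' t) t)
    (hw' : ∀ t, HasDerivAt w' (lam ^ 2 * w t - f t) t) (hlam : 0 < lam) (t : ℝ) :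
    0 < lam * w t - w' t := by
  have h := mul_add_deriv_pos (w := fun t => w (-t)) (w' := fun t => -w' (-t))
    (f := fun t => f (-t)) (fun t => hw0 _) (fun t => hf _)
    (fun t => ((hw (-t)).scomp t (hasDerivAt_neg t)).congr_deriv (by simp))
    (fun t => ((hw' (-t)).scomp t (hasDerivAt_neg t)).fun_neg.congr_deriv (by simp)) hlam (-t)
  simpa [sub_eq_add_neg] using h

lemma tendsto_zero_of_integrable_sq {g : ℝ → ℝ} {lam : ℝ} (hg0 : ∀ t, 0 < g t)
    (hgc : Continuous g) (hlam : 0 < lam) (hmono : Monotone fun t => exp (lam * t) * g t)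
    (hint : Integrable fun t => g t ^ 2) :
    Tendsto g atTop (𝓝 0) ∧ Tendsto g atBot (𝓝 0) := by
  have hii : ∀ a b, IntervalIntegrable (fun t => g t ^ 2) volume a b :=
    fun a b => (hgc.pow 2).intervalIntegrable a b
  have hle : ∀ t, g t ^ 2 ≤ exp (2 * lam) * ∫ s in t..(t + 1), g s ^ 2 := by
    intro t
    have h1 : ∀ s ∈ Set.Icc t (t + 1), (exp (-lam) * g t) ^ 2 ≤ g s ^ 2 := by
      intro s hs
      have h2 := hmono hs.1
      have h3 : exp (-lam) * g t ≤ exp (lam * t - lam * s) * g t := by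
        refine mul_le_mul_of_nonneg_right (exp_le_exp.2 ?_) (hg0 t).le
        nlinarith [hs.2]
      have h4 : exp (lam * t - lam * s) * g t ≤ g s := by
        rw [exp_sub, div_mul_eq_mul_div, div_le_iff₀ (exp_pos _), mul_comm (g s)]
        exact h2
      have : 0 ≤ exp (-lam) * g t := (mul_pos (exp_pos _) (hg0 t)).le
      gcongr
      exact h3.trans h4
    have h5 := intervalIntegral.integral_mono_on (by linarith : t ≤ t + 1)
      (intervalIntegrable_const (c := (exp (-lam) * g t) ^ 2)) (hii t (t + 1)) h1
    rw [intervalIntegral.integral_const, add_sub_cancel_left, one_smul] at h5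
    calc g t ^ 2 = exp (2 * lam) * (exp (-lam) * g t) ^ 2 := by
          rw [mul_pow, ← Real.exp_nat_mul, ← mul_assoc, ← exp_add]
          simp
      _ ≤ _ := mul_le_mul_of_nonneg_left h5 (exp_pos _).le
  have key : ∀ l : Filter ℝ, Tendsto (fun t => ∫ s in t..(t + 1), g s ^ 2) l (𝓝 0) →
      Tendsto g l (𝓝 0) := by
    intro l hl
    have h1 : Tendsto (fun t => g t ^ 2) l (𝓝 0) := by
      refine squeeze_zero (fun t => sq_nonneg _) hle ?_
      simpa using hl.const_mul (exp (2 * lam))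
    have h2 := (Real.continuous_sqrt.tendsto 0).comp h1
    rw [Real.sqrt_zero] at h2
    exact h2.congr fun t => Real.sqrt_sq (hg0 t).le
  constructor
  · refine key _ ?_
    have h := intervalIntegral_tendsto_integral_Ioi 0 hint.integrableOn tendsto_id
    have h' := intervalIntegral_tendsto_integral_Ioi 0 hint.integrableOn
      (tendsto_atTop_add_const_right atTop (1 : ℝ) tendsto_id)
    have := h'.sub h
    rw [sub_self] at this
    exact this.congr fun t => intervalIntegral.integral_interval_sub_left (hii _ _) (hii _ _)
  · refine key _ ?_
    have h := intervalIntegral_tendsto_integral_Iic 0 hint.integrableOn tendsto_id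
    have h' := intervalIntegral_tendsto_integral_Iic 0 hint.integrableOn
      (tendsto_atBot_add_const_right atBot (1 : ℝ) tendsto_id)
    have := h.sub h'
    rw [sub_self] at this
    refine this.congr fun t => ?_
    have := intervalIntegral.integral_add_adjacent_intervals (hii t (t + 1)) (hii (t + 1) 0)
    simp only [id]
    linarith

lemma hasDerivAt_mul_sub {w w' : ℝ → ℝ} {lam f t : ℝ} (hw : HasDerivAt w (w' t) t)
    (hw' : HasDerivAt w' (lam ^ 2 * w t - f) t) :
    HasDerivAt (fun t => lam * w t - w' t) (f - lam * (lam * w t - w' t)) t :=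
  ((hw.const_mul lam).fun_sub hw').congr_deriv (by ring)

lemma hasDerivAt_mul_add {w w' : ℝ → ℝ} {lam f t : ℝ} (hw : HasDerivAt w (w' t) t)
    (hw' : HasDerivAt w' (lam ^ 2 * w t - f) t) :
    HasDerivAt (fun t => lam * w t + w' t) (lam * (lam * w t + w' t) - f) t :=
  ((hw.const_mul lam).fun_add hw').congr_deriv (by ring)

lemma tendsto_zero_of_emden {w w' f : ℝ → ℝ} {lam r : ℝ} (hw0 : ∀ t, 0 < w t)
    (hf : ∀ t, w t ^ r ≤ f t) (hw : ∀ t, HasDerivAt w (w' t) t)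
    (hw' : ∀ t, HasDerivAt w' (lam ^ 2 * w t - f t) t) (hlam : 0 < lam) (hr : 0 ≤ r)
    (hint : Integrable fun t => (lam * w t - w' t) ^ 2) :
    Tendsto w atTop (𝓝 0) ∧ Tendsto w atBot (𝓝 0) := by
  have hf0 : ∀ t, 0 < f t := fun t => (Real.rpow_pos_of_pos (hw0 t) r).trans_le (hf t)
  have hg0 := mul_sub_deriv_pos hw0 hf0 hw hw' hlam
  have hg := fun t => hasDerivAt_mul_sub (hw t) (hw' t)
  set g := fun t => lam * w t - w' t with hgdef
  have hwg : ∀ t, w' t = lam * w t - g t := fun t => by simp [hgdef]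
  have hmono : Monotone fun t => exp (lam * t) * g t := by
    refine monotone_of_hasDerivAt_nonneg (fun t => hasDerivAt_exp_mul_mul (hg t)) fun t => ?_
    have : 0 < exp (lam * t) * f t := mul_pos (exp_pos _) (hf0 t)
    simp only [Pi.zero_apply, hgdef]
    linarith
  obtain ⟨htop, hbot⟩ := tendsto_zero_of_integrable_sq hg0
    (continuous_iff_continuousAt.2 fun t => (hg t).continuousAt) hlam hmono hint
  constructor
  · rw [Metric.tendsto_atTop]
    intro δ hδ
    have hδr : 0 < δ ^ r := Real.rpow_pos_of_pos hδ r
    have hε : 0 < min (lam * δ) (δ ^ r / (2 * lam)) := by positivity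
    obtain ⟨T, hT⟩ := eventually_atTop.1 (htop.eventually (gt_mem_nhds hε))
    refine ⟨T, fun t ht => ?_⟩
    rw [Real.dist_eq, sub_zero, abs_of_pos (hw0 t)]
    by_contra! hge
    have hwge : ∀ s, t ≤ s → δ ≤ w s := by
      have hm : MonotoneOn (fun s => exp (-lam * s) * (w s - δ)) (Set.Ici t) := by
        have hd : ∀ s, HasDerivAt (fun s => exp (-lam * s) * (w s - δ))
            (exp (-lam * s) * (lam * δ - g s)) s := fun s =>
          (hasDerivAt_exp_mul_mul ((hw s).sub_const δ)).congr_deriv (by rw [hwg]; ring)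
        refine monotoneOn_of_deriv_nonneg (convex_Ici t)
          (fun t _ => (hd t).continuousAt.continuousWithinAt)
          (fun t _ => (hd t).differentiableAt.differentiableWithinAt) fun s hs => ?_
        rw [interior_Ici] at hs
        rw [(hd s).deriv]
        have h1 := (hT s (ht.le.trans (le_of_lt hs))).trans_le (min_le_left _ _)
        exact mul_nonneg (exp_pos _).le (by linarith)
      intro s hs
      have h1 := hm (Set.mem_Ici.2 le_rfl) (Set.mem_Ici.2 hs) hs
      have h2 : 0 ≤ exp (-lam * t) * (w t - δ) := mul_nonneg (exp_pos _).le (by linarith)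
      have h3 := (h2.trans h1)
      have h4 := nonneg_of_mul_nonneg_right h3 (exp_pos _)
      linarith
    have hgle : ∀ s, t ≤ s → lam * g s ≤ δ ^ r / 2 := fun s hs => by
      have h1 := (hT s (ht.le.trans hs)).le.trans (min_le_right _ _)
      rw [le_div_iff₀ (by positivity)] at h1
      linarith
    obtain ⟨s, hts, hs⟩ := exists_nonpos_of_deriv_le
      (fun s => (hg s).const_sub (δ ^ r / (2 * lam) + 1)) (half_pos hδr) (T := t) fun s hs => by
        have h1 := (Real.rpow_le_rpow hδ.le (hwge s hs) hr).trans (hf s)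
        have h2 := hgle s hs
        simp only [hgdef] at h2
        linarith
    have h1 := (hT s (ht.le.trans hts)).le.trans (min_le_right _ _)
    linarith
  · rw [Metric.tendsto_nhds]
    intro δ hδ
    obtain ⟨T, hT⟩ := eventually_atBot.1 (hbot.eventually (gt_mem_nhds (by positivity :
      0 < lam * (δ / 2))))
    have hm : MonotoneOn (fun s => exp (-lam * s) * (w s - δ / 2)) (Set.Iic T) := by
      have hd : ∀ s, HasDerivAt (fun s => exp (-lam * s) * (w s - δ / 2))
          (exp (-lam * s) * (lam * (δ / 2) - g s)) s := fun s =>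
        (hasDerivAt_exp_mul_mul ((hw s).sub_const (δ / 2))).congr_deriv (by rw [hwg]; ring)
      refine monotoneOn_of_deriv_nonneg (convex_Iic T)
        (fun t _ => (hd t).continuousAt.continuousWithinAt)
        (fun t _ => (hd t).differentiableAt.differentiableWithinAt) fun s hs => ?_
      rw [interior_Iic] at hs
      rw [(hd s).deriv]
      exact mul_nonneg (exp_pos _).le (by linarith [hT s (le_of_lt hs)])
    set c := |exp (-lam * T) * (w T - δ / 2)| with hc
    have hlim : Tendsto (fun t => exp (lam * t) * c) atBot (𝓝 0) := by
      have h1 : Tendsto (fun t => lam * t) atBot atBot := tendsto_id.const_mul_atBot hlam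
      simpa using (Real.tendsto_exp_atBot.comp h1).mul_const c
    filter_upwards [eventually_le_atBot T, hlim.eventually (gt_mem_nhds (half_pos hδ))] with t ht h2
    have h1 := hm (Set.mem_Iic.2 ht) (Set.mem_Iic.2 le_rfl) ht
    simp only at h1
    have h3 : exp (-lam * t) * (w t - δ / 2) ≤ c := h1.trans (le_abs_self _)
    have h4 : w t - δ / 2 ≤ exp (lam * t) * c := by
      have h5 := mul_le_mul_of_nonneg_left h3 (exp_pos (lam * t)).le
      rwa [← mul_assoc, ← exp_add, show lam * t + -lam * t = 0 by ring, exp_zero, one_mul] at h5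
    rw [Real.dist_eq, sub_zero, abs_of_pos (hw0 t)]
    linarith

end Emden

/-- A positive solution of the autonomous Emden–Fowler system whose transformed energy is finite. -/
structure IsEmdenPair (lam p ν α β : ℝ) (w z w' z' : ℝ → ℝ) : Prop where
  pos_left : ∀ t, 0 < w t
  pos_right : ∀ t, 0 < z t
  hasDerivAt_left : ∀ t, HasDerivAt w (w' t) t
  hasDerivAt_right : ∀ t, HasDerivAt z (z' t) t
  hasDerivAt_left' : ∀ t, HasDerivAt w' (lam ^ 2 * w t - coupling p ν α β (w t) (z t)) t
  hasDerivAt_right' : ∀ t, HasDerivAt z' (lam ^ 2 * z t - coupling p ν β α (z t) (w t)) t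
  integrable_left : Integrable fun t => (lam * w t - w' t) ^ 2
  integrable_right : Integrable fun t => (lam * z t - z' t) ^ 2

/-- The quantity measuring how far a component of an Emden–Fowler pair is from a bubble. -/
def emdenDefect (lam p ν α β : ℝ) (w z w' : ℝ → ℝ) (t : ℝ) : ℝ :=
  p * (lam ^ 2 * w t ^ 2 - w' t ^ 2) - 2 * (w t ^ p + ν * α * w t ^ α * z t ^ β)

namespace IsEmdenPair

variable {lam p ν α β : ℝ} {w z w' z' : ℝ → ℝ}

lemma symm (h : IsEmdenPair lam p ν α β w z w' z') : IsEmdenPair lam p ν β α z w z' w' :=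
  ⟨h.2, h.1, h.4, h.3, h.6, h.5, h.8, h.7⟩

variable (h : IsEmdenPair lam p ν α β w z w' z') (hlam : 0 < lam) (hp : 2 < p) (hν : 0 < ν)
  (hα : 1 < α) (hβ : 1 < β) (hαβ : α + β = p)

section
include h hlam hν hα

lemma mul_add_pos (t : ℝ) : 0 < lam * w t + w' t :=
  mul_add_deriv_pos h.1 (fun t => coupling_pos hν hα (h.1 t) (h.2 t)) h.3 h.5 hlam t

lemma mul_sub_pos (t : ℝ) : 0 < lam * w t - w' t :=
  mul_sub_deriv_pos h.1 (fun t => coupling_pos hν hα (h.1 t) (h.2 t)) h.3 h.5 hlam t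

include hp

lemma tendsto_zero : Tendsto w atTop (𝓝 0) ∧ Tendsto w atBot (𝓝 0) := by
  refine tendsto_zero_of_emden (r := p - 1) h.1 (fun t => ?_) h.3 h.5 hlam (by linarith) h.7
  have := h.1 t
  have := h.2 t
  have : 0 < α := by linarith
  exact le_add_of_nonneg_right (by positivity)

lemma tendsto_zero' : Tendsto w' atTop (𝓝 0) ∧ Tendsto w' atBot (𝓝 0) := by
  have key : ∀ l, Tendsto w l (𝓝 0) → Tendsto w' l (𝓝 0) := fun l hl => by
    refine squeeze_zero_norm (a := fun t => lam * w t) (fun t => ?_) (by simpa using hl.const_mul lam)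
    rw [Real.norm_eq_abs, abs_le]
    constructor <;> linarith [h.mul_add_pos hlam hν hα t, h.mul_sub_pos hlam hν hα t]
  exact ⟨key _ (h.tendsto_zero hlam hp hν hα).1, key _ (h.tendsto_zero hlam hp hν hα).2⟩

end

section
include h

lemma hasDerivAt_rpow (r t : ℝ) : HasDerivAt (fun t => w t ^ r) (w' t * r * w t ^ (r - 1)) t :=
  (h.3 t).rpow_const (Or.inl (h.1 t).ne')

include hαβ

lemma hasDerivAt_emdenDefect (t : ℝ) :
    HasDerivAt (emdenDefect lam p ν α β w z w')
      (2 * ν * α * β * (w t ^ (α - 1) * z t ^ (β - 1)) * (w' t * z t - w t * z' t)) t := by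
  have h1 := (((h.3 t).fun_pow 2).const_mul (lam ^ 2)).fun_sub ((h.5 t).fun_pow 2)
  have h2 := ((h.hasDerivAt_rpow α t).const_mul (ν * α)).fun_mul (h.symm.hasDerivAt_rpow β t)
  refine ((h1.const_mul p).fun_sub (((h.hasDerivAt_rpow p t).fun_add h2).const_mul 2)).congr_deriv ?_
  have e1 : w t ^ α = w t ^ (α - 1) * w t := by
    rw [← Real.rpow_add_one (h.1 t).ne', sub_add_cancel]
  have e2 : z t ^ β = z t ^ (β - 1) * z t := by
    rw [← Real.rpow_add_one (h.2 t).ne', sub_add_cancel]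
  simp only [coupling]
  rw [e1, e2, ← hαβ]
  push_cast
  ring

include hlam hp hν hα hβ

lemma emdenDefect_tendsto :
    Tendsto (emdenDefect lam p ν α β w z w') atTop (𝓝 0) ∧
      Tendsto (emdenDefect lam p ν α β w z w') atBot (𝓝 0) := by
  have key : ∀ l, Tendsto w l (𝓝 0) → Tendsto z l (𝓝 0) → Tendsto w' l (𝓝 0) →
      Tendsto (emdenDefect lam p ν α β w z w') l (𝓝 0) := by
    intro l h1 h2 h3
    have r : ∀ {f : ℝ → ℝ} {r : ℝ}, Tendsto f l (𝓝 0) → 0 < r →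
        Tendsto (fun t => f t ^ r) l (𝓝 0) := fun {f r} hf hr => by
      have := hf.rpow_const (p := r) (Or.inr hr.le)
      rwa [Real.zero_rpow hr.ne'] at this
    have := ((((h1.pow 2).const_mul (lam ^ 2)).sub (h3.pow 2)).const_mul p).sub
      (((r h1 (by linarith : 0 < p)).add (((r h1 (by linarith : 0 < α)).const_mul (ν * α)).mul
        (r h2 (by linarith : 0 < β)))).const_mul 2)
    change Tendsto (fun t => emdenDefect lam p ν α β w z w' t) l (𝓝 0)
    simpa [emdenDefect] using this
  have a1 := h.tendsto_zero hlam hp hν hα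
  have a2 := h.symm.tendsto_zero hlam hp hν hβ
  have a3 := h.tendsto_zero' hlam hp hν hα
  exact ⟨key _ a1.1 a2.1 a3.1, key _ a1.2 a2.2 a3.2⟩

lemma emdenDefect_add_eq_zero (t : ℝ) :
    emdenDefect lam p ν α β w z w' t + emdenDefect lam p ν β α z w z' t = 0 := by
  have hd : ∀ t, HasDerivAt (fun t => emdenDefect lam p ν α β w z w' t
      + emdenDefect lam p ν β α z w z' t) 0 t := fun t =>
    ((h.hasDerivAt_emdenDefect hαβ t).fun_add
      (h.symm.hasDerivAt_emdenDefect (by linarith) t)).congr_deriv (by ring)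
  have hc := is_const_of_deriv_eq_zero (fun t => (hd t).differentiableAt) fun t => (hd t).deriv
  have hl := (h.emdenDefect_tendsto hlam hp hν hα hβ hαβ).1.add
    (h.symm.emdenDefect_tendsto hlam hp hν hβ hα (by linarith)).1
  rw [add_zero] at hl
  exact tendsto_nhds_unique
    (tendsto_const_nhds.congr fun s => hc t s) hl

omit hp hβ hαβ in
/-- The derivative of `exp (lam (p - 2) t) (lam w + w') / (lam w - w')` is a positive multiple of the
defect. -/
lemma hasDerivAt_quotient (t : ℝ) :
    HasDerivAt (fun t => exp (lam * (p - 2) * t) * ((lam * w t + w' t) / (lam * w t - w' t)))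
      (lam * exp (lam * (p - 2) * t) * emdenDefect lam p ν α β w z w' t
        / (lam * w t - w' t) ^ 2) t := by
  have hg := h.mul_sub_pos hlam hν hα t
  have h1 := hasDerivAt_exp_mul_mul (c := lam * (p - 2))
    ((hasDerivAt_mul_add (h.3 t) (h.5 t)).fun_div (hasDerivAt_mul_sub (h.3 t) (h.5 t)) hg.ne')
  refine h1.congr_deriv ?_
  have e0 : coupling p ν α β (w t) (z t) * w t = w t ^ p + ν * α * w t ^ α * z t ^ β := by
    have e1 : w t ^ α = w t ^ (α - 1) * w t := by
      rw [← Real.rpow_add_one (h.1 t).ne', sub_add_cancel]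
    have e2 : w t ^ p = w t ^ (p - 1) * w t := by
      rw [← Real.rpow_add_one (h.1 t).ne', sub_add_cancel]
    rw [coupling, e1, e2]
    ring
  rw [emdenDefect, ← e0]
  field_simp
  ring

lemma emdenDefect_eq_zero (t : ℝ) : emdenDefect lam p ν α β w z w' t = 0 := by
  have hW := h.hasDerivAt_emdenDefect hαβ
  have hA := h.hasDerivAt_quotient hlam hν hα
  have hB := h.symm.hasDerivAt_quotient hlam hν hβ
  have hZ : ∀ t, emdenDefect lam p ν β α z w z' t = -emdenDefect lam p ν α β w z w' t :=
    fun t => by linarith [h.emdenDefect_add_eq_zero hlam hp hν hα hβ hαβ t]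
  obtain ⟨htop, hbot⟩ := h.emdenDefect_tendsto hlam hp hν hα hβ hαβ
  have gw := h.mul_sub_pos hlam hν hα
  have gz := h.symm.mul_sub_pos hlam hν hβ
  set W := emdenDefect lam p ν α β w z w' with hWdef
  set d : ℝ → ℝ := fun t => exp (lam * (p - 2) * t) * ((lam * w t + w' t) / (lam * w t - w' t))
    - exp (lam * (p - 2) * t) * ((lam * z t + z' t) / (lam * z t - z' t)) with hd
  set c : ℝ → ℝ := fun t => 2 * ν * α * β * (w t ^ (α - 1) * z t ^ (β - 1)) with hc
  set j : ℝ → ℝ := fun t => w' t * z t - w t * z' t with hj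
  have hc0 : ∀ t, 0 < c t := fun t => by
    have := Real.rpow_pos_of_pos (h.1 t) (α - 1)
    have := Real.rpow_pos_of_pos (h.2 t) (β - 1)
    simp only [hc]; positivity
  set r : ℝ → ℝ := fun t => exp (lam * (p - 2) * t) * (2 * lam)
    / ((lam * w t - w' t) * (lam * z t - z' t)) with hr
  have hr0 : ∀ t, 0 < r t := fun t => by
    have := gw t
    have := gz t
    simp only [hr]; positivity
  have hdj : ∀ t, d t = r t * j t := fun t => by
    have := (gw t).ne'
    have := (gz t).ne'
    simp only [hd, hr, hj]
    field_simp
    ring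
  set m : ℝ → ℝ := fun t => lam * exp (lam * (p - 2) * t) * (1 / (lam * w t - w' t) ^ 2
    + 1 / (lam * z t - z' t) ^ 2) with hm
  have hm0 : ∀ t, 0 < m t := fun t => by
    have := gw t
    have := gz t
    simp only [hm]; positivity
  have hd' : ∀ t, HasDerivAt d (W t * m t) t := fun t =>
    ((hA t).fun_sub (hB t)).congr_deriv (by rw [hZ]; simp only [hm]; ring)
  have hQ : Monotone fun t => W t * d t := by
    refine monotone_of_hasDerivAt_nonneg (fun t => (hW t).fun_mul (hd' t)) fun t => ?_
    have e : c t * j t * d t + W t * (W t * m t) = c t * r t * j t ^ 2 + m t * W t ^ 2 := by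
      rw [hdj]; ring
    rw [Pi.zero_apply]
    refine le_of_le_of_eq ?_ e.symm
    have := hc0 t
    have := hr0 t
    have := hm0 t
    positivity
  have hsq : ∀ t, HasDerivAt (fun t => W t ^ 2) (2 * (c t / r t) * (W t * d t)) t := fun t => by
    refine ((hW t).fun_pow 2).congr_deriv ?_
    have := (hr0 t).ne'
    rw [hdj]
    push_cast
    field_simp
    ring
  have hcr : ∀ t, 0 ≤ 2 * (c t / r t) := fun t => by
    have := hc0 t
    have := hr0 t
    positivity
  suffices W t ^ 2 ≤ 0 from pow_eq_zero_iff two_ne_zero |>.1 (le_antisymm this (sq_nonneg _))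
  rcases le_total 0 (W t * d t) with h0 | h0
  · have hmono : MonotoneOn (fun t => W t ^ 2) (Set.Ici t) := by
      refine monotoneOn_of_deriv_nonneg (convex_Ici t)
        (fun t _ => (hsq t).continuousAt.continuousWithinAt)
        (fun t _ => (hsq t).differentiableAt.differentiableWithinAt) fun s hs => ?_
      rw [interior_Ici] at hs
      rw [(hsq s).deriv]
      exact mul_nonneg (hcr s) (h0.trans (hQ (le_of_lt hs)))
    refine ge_of_tendsto (by simpa using htop.pow 2) ?_
    filter_upwards [eventually_ge_atTop t] with s hs using hmono (Set.mem_Ici.2 le_rfl) hs hs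
  · have hanti : AntitoneOn (fun t => W t ^ 2) (Set.Iic t) := by
      refine antitoneOn_of_deriv_nonpos (convex_Iic t)
        (fun t _ => (hsq t).continuousAt.continuousWithinAt)
        (fun t _ => (hsq t).differentiableAt.differentiableWithinAt) fun s hs => ?_
      rw [interior_Iic] at hs
      rw [(hsq s).deriv]
      exact mul_nonpos_of_nonneg_of_nonpos (hcr s) ((hQ (le_of_lt hs)).trans h0)
    refine ge_of_tendsto (by simpa using hbot.pow 2) ?_
    filter_upwards [eventually_le_atBot t] with s hs using hanti hs (Set.mem_Iic.2 le_rfl) hs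

end

end IsEmdenPair

/-- The one-dimensional profile `exp (κt) + m exp (-κt)` of a bubble. -/
def bubbleProfile (κ m t : ℝ) : ℝ := exp (κ * t) + m * exp (-κ * t)

lemma bubbleProfile_pos {κ m : ℝ} (hm : 0 < m) (t : ℝ) : 0 < bubbleProfile κ m t := by
  unfold bubbleProfile; positivity

lemma hasDerivAt_bubbleProfile (κ m t : ℝ) :
    HasDerivAt (bubbleProfile κ m) (κ * (exp (κ * t) - m * exp (-κ * t))) t :=
  ((hasD2_exp_mul κ t).hasDerivAt.fun_add
    ((hasD2_exp_mul (-κ) t).hasDerivAt.const_mul m)).congr_deriv (by ring)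

namespace IsEmdenPair

variable {lam p ν α β : ℝ} {w z w' z' : ℝ → ℝ}

section
variable (h : IsEmdenPair lam p ν α β w z w' z') (hlam : 0 < lam) (hp : 2 < p) (hν : 0 < ν)
  (hα : 1 < α) (hβ : 1 < β) (hαβ : α + β = p)
include h hlam hp hν hα hβ hαβ

lemma exists_quotient_eq : ∃ m, 0 < m ∧ ∀ t,
    exp (lam * (p - 2) * t) * (lam * w t + w' t) = m * (lam * w t - w' t) ∧
    exp (lam * (p - 2) * t) * (lam * z t + z' t) = m * (lam * z t - z' t) := by
  have gw := h.mul_sub_pos hlam hν hα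
  have gz := h.symm.mul_sub_pos hlam hν hβ
  have hW := h.emdenDefect_eq_zero hlam hp hν hα hβ hαβ
  have hZ := h.symm.emdenDefect_eq_zero hlam hp hν hβ hα (by linarith)
  have hA : ∀ t, HasDerivAt (fun t => exp (lam * (p - 2) * t) *
      ((lam * w t + w' t) / (lam * w t - w' t))) 0 t := fun t =>
    (h.hasDerivAt_quotient hlam hν hα t).congr_deriv (by rw [hW]; simp)
  have hB : ∀ t, HasDerivAt (fun t => exp (lam * (p - 2) * t) *
      ((lam * z t + z' t) / (lam * z t - z' t))) 0 t := fun t =>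
    (h.symm.hasDerivAt_quotient hlam hν hβ t).congr_deriv (by rw [hZ]; simp)
  have hj : w' 0 * z 0 - w 0 * z' 0 = 0 := by
    have h1 := h.hasDerivAt_emdenDefect hαβ 0
    rw [show emdenDefect lam p ν α β w z w' = fun _ => 0 from funext hW] at h1
    have h2 := h1.unique (hasDerivAt_const 0 0)
    have := Real.rpow_pos_of_pos (h.1 0) (α - 1)
    have := Real.rpow_pos_of_pos (h.2 0) (β - 1)
    exact (mul_eq_zero.1 h2).resolve_left (by positivity)
  have cA := is_const_of_deriv_eq_zero (fun t => (hA t).differentiableAt) fun t => (hA t).deriv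
  have cB := is_const_of_deriv_eq_zero (fun t => (hB t).differentiableAt) fun t => (hB t).deriv
  have hAB : (lam * w 0 + w' 0) / (lam * w 0 - w' 0) = (lam * z 0 + z' 0) / (lam * z 0 - z' 0) := by
    rw [div_eq_div_iff (gw 0).ne' (gz 0).ne']
    linear_combination (2 * lam) * hj
  refine ⟨(lam * w 0 + w' 0) / (lam * w 0 - w' 0),
    div_pos (h.mul_add_pos hlam hν hα 0) (gw 0), fun t => ⟨?_, ?_⟩⟩
  · have h1 := cA t 0
    simp only [mul_zero, exp_zero, one_mul] at h1
    rw [← h1]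
    have := (gw t).ne'
    field_simp
  · have h1 := cB t 0
    simp only [mul_zero, exp_zero, one_mul] at h1
    rw [hAB, ← h1]
    have := (gz t).ne'
    field_simp

end

lemma deriv_mul_bubbleProfile {m κ a b t : ℝ} (hκ : 2 * κ = lam * (p - 2))
    (h : exp (lam * (p - 2) * t) * (lam * a + b) = m * (lam * a - b)) :
    b * bubbleProfile κ m t = -(lam * a * (exp (κ * t) - m * exp (-κ * t))) := by
  have e : exp (lam * (p - 2) * t) = exp (κ * t) * exp (κ * t) := by
    rw [← exp_add, ← hκ]; congr 1; ring
  have e2 : exp (-κ * t) * exp (κ * t) = 1 := by rw [← exp_add]; simp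
  rw [e] at h
  unfold bubbleProfile
  linear_combination exp (-κ * t) * h - (exp (κ * t) * (lam * a + b)) * e2

lemma exists_eq_mul_bubbleProfile {m κ : ℝ} (hm : 0 < m) (hp : 2 < p)
    (hκ : 2 * κ = lam * (p - 2)) (hw0 : ∀ t, 0 < w t) (hw : ∀ t, HasDerivAt w (w' t) t)
    (h : ∀ t, w' t * bubbleProfile κ m t = -(lam * w t * (exp (κ * t) - m * exp (-κ * t)))) :
    ∃ C, 0 < C ∧ ∀ t, w t = C * bubbleProfile κ m t ^ (-(2 / (p - 2))) := by
  have hd : ∀ t, HasDerivAt (fun t => w t * bubbleProfile κ m t ^ (2 / (p - 2))) 0 t := by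
    intro t
    have hb := bubbleProfile_pos (κ := κ) hm t
    refine ((hw t).fun_mul ((hasDerivAt_bubbleProfile κ m t).rpow_const
      (p := 2 / (p - 2)) (Or.inl hb.ne'))).congr_deriv ?_
    have e : bubbleProfile κ m t ^ (2 / (p - 2))
        = bubbleProfile κ m t ^ (2 / (p - 2) - 1) * bubbleProfile κ m t := by
      rw [← Real.rpow_add_one hb.ne', sub_add_cancel]
    have e2 : κ * (2 / (p - 2)) = lam := by
      have : p - 2 ≠ 0 := by linarith
      field_simp
      linarith
    rw [e]
    linear_combination (bubbleProfile κ m t ^ (2 / (p - 2) - 1)) * h t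
      + (w t * (exp (κ * t) - m * exp (-κ * t)) * bubbleProfile κ m t ^ (2 / (p - 2) - 1)) * e2
  have hc := is_const_of_deriv_eq_zero (fun t => (hd t).differentiableAt) fun t => (hd t).deriv
  refine ⟨w 0 * bubbleProfile κ m 0 ^ (2 / (p - 2)), mul_pos (hw0 0)
    (Real.rpow_pos_of_pos (bubbleProfile_pos hm 0) _), fun t => ?_⟩
  have hb := bubbleProfile_pos (κ := κ) hm t
  rw [← hc t 0, Real.rpow_neg hb.le, mul_assoc,
    mul_inv_cancel₀ (Real.rpow_pos_of_pos hb _).ne', mul_one]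

lemma coeff_relation {m κ C C₂ t : ℝ} (hm : 0 < m) (hp : 2 < p)
    (hαβ : α + β = p) (hC : 0 < C) (hC₂ : 0 < C₂)
    (hw : w t = C * bubbleProfile κ m t ^ (-(2 / (p - 2))))
    (hz : z t = C₂ * bubbleProfile κ m t ^ (-(2 / (p - 2))))
    (h : w' t * bubbleProfile κ m t = -(lam * w t * (exp (κ * t) - m * exp (-κ * t))))
    (hW : emdenDefect lam p ν α β w z w' t = 0) :
    C ^ (p - 2) + ν * α * C ^ (α - 2) * C₂ ^ β = 2 * lam ^ 2 * p * m := by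
  have hb := bubbleProfile_pos (κ := κ) hm t
  have hbdef : bubbleProfile κ m t = exp (κ * t) + m * exp (-κ * t) := rfl
  set b := bubbleProfile κ m t
  set B := b ^ (-(2 / (p - 2))) with hB
  have hB0 : 0 < B := Real.rpow_pos_of_pos hb _
  have e2 : exp (κ * t) * exp (-κ * t) = 1 := by rw [← exp_add]; simp
  have hBp : B ^ p * b ^ 2 = B ^ 2 := by
    have hp2 : p - 2 ≠ 0 := by linarith
    rw [hB, ← Real.rpow_mul hb.le, ← Real.rpow_natCast, ← Real.rpow_natCast, ← Real.rpow_mul hb.le,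
      ← Real.rpow_add hb]
    congr 1
    push_cast
    field_simp
    ring
  have hBs : B ^ α * B ^ β = B ^ p := by rw [← Real.rpow_add hB0, hαβ]
  have hP : (lam ^ 2 * w t ^ 2 - w' t ^ 2) * b ^ 2 = 4 * m * lam ^ 2 * w t ^ 2 := by
    have h2 : (w' t * b) ^ 2 = (lam * w t * (exp (κ * t) - m * exp (-κ * t))) ^ 2 := by
      rw [h, neg_sq]
    rw [hbdef] at h2 ⊢
    linear_combination (-1) * h2 + (4 * m * lam ^ 2 * w t ^ 2) * e2
  rw [emdenDefect, hw, hz] at hW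
  rw [hw] at hP
  rw [Real.mul_rpow hC.le hB0.le, Real.mul_rpow hC.le hB0.le, Real.mul_rpow hC₂.le hB0.le] at hW
  have c1 : C ^ p = C ^ (p - 2) * C ^ 2 := by
    rw [← Real.rpow_natCast, ← Real.rpow_add hC]; congr 1; push_cast; ring
  have c2 : C ^ α = C ^ (α - 2) * C ^ 2 := by
    rw [← Real.rpow_natCast, ← Real.rpow_add hC]; congr 1; push_cast; ring
  rw [c1, c2] at hW
  have key : (2 * B ^ 2 * C ^ 2) * (C ^ (p - 2) + ν * α * C ^ (α - 2) * C₂ ^ β)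
      = (2 * B ^ 2 * C ^ 2) * (2 * lam ^ 2 * p * m) := by
    linear_combination (-b ^ 2) * hW + p * hP
      - 2 * (C ^ (p - 2) * C ^ 2 + ν * α * C ^ (α - 2) * C ^ 2 * C₂ ^ β) * hBp
      - 2 * (ν * α * C ^ (α - 2) * C ^ 2 * C₂ ^ β * b ^ 2) * hBs
  exact mul_left_cancel₀ (by positivity) key

lemma exists_bubble (h : IsEmdenPair lam p ν α β w z w' z') (hlam : 0 < lam) (hp : 2 < p)
    (hν : 0 < ν) (hα : 1 < α) (hβ : 1 < β) (hαβ : α + β = p) {κ : ℝ}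
    (hκ : 2 * κ = lam * (p - 2)) :
    ∃ m C C₂ : ℝ, 0 < m ∧ 0 < C ∧ 0 < C₂ ∧
      (∀ t, w t = C * bubbleProfile κ m t ^ (-(2 / (p - 2)))) ∧
      (∀ t, z t = C₂ * bubbleProfile κ m t ^ (-(2 / (p - 2)))) ∧
      C ^ (p - 2) + ν * α * C ^ (α - 2) * C₂ ^ β = 2 * lam ^ 2 * p * m ∧
      C₂ ^ (p - 2) + ν * β * C ^ α * C₂ ^ (β - 2) = 2 * lam ^ 2 * p * m := by
  obtain ⟨m, hm, hquot⟩ := h.exists_quotient_eq hlam hp hν hα hβ hαβ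
  have dw := fun t => deriv_mul_bubbleProfile hκ (hquot t).1
  have dz := fun t => deriv_mul_bubbleProfile hκ (hquot t).2
  obtain ⟨C, hC, hw⟩ := exists_eq_mul_bubbleProfile hm hp hκ h.1 h.3 dw
  obtain ⟨C₂, hC₂, hz⟩ := exists_eq_mul_bubbleProfile hm hp hκ h.2 h.4 dz
  refine ⟨m, C, C₂, hm, hC, hC₂, hw, hz, ?_, ?_⟩
  · exact coeff_relation hm hp hαβ hC hC₂ (hw 0) (hz 0) (dw 0)
      (h.emdenDefect_eq_zero hlam hp hν hα hβ hαβ 0)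
  · have := coeff_relation hm hp (by linarith) hC₂ hC (hz 0) (hw 0) (dz 0)
      (h.symm.emdenDefect_eq_zero hlam hp hν hβ hα (by linarith) 0)
    rw [← this]
    ring

end IsEmdenPair

lemma bubble_eq {n : ℕ} {a b p lam κ : ℝ} (hN : 0 < (n : ℝ) - 2 * (1 + a - b))
    (hs : 0 < 1 + a - b) (hp : p = 2 * n / ((n : ℝ) - 2 * (1 + a - b)))
    (hlam : 2 * lam = n - 2 - 2 * a) (hκ : 2 * κ = lam * (p - 2)) (x : EuclideanSpace ℝ (Fin n)) :
    bubble n a b x = (2 * lam ^ 2 * p) ^ (1 / (p - 2)) *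
      (1 + ‖x‖ ^ (2 * κ)) ^ (-(2 / (p - 2))) := by
  have hp2 : p - 2 = 4 * (1 + a - b) / ((n : ℝ) - 2 * (1 + a - b)) := by
    rw [hp]; field_simp; ring
  rw [bubble, hκ, ← hlam, hp2]
  congr 1
  · congr 1
    · rw [hp]; field_simp
    · field_simp
  · congr 1
    · congr 2
      field_simp; ring
    · field_simp; ring

lemma bubbleMu_eq {n : ℕ} {a b p lam κ m : ℝ} (hN : 0 < (n : ℝ) - 2 * (1 + a - b))
    (hs : 0 < 1 + a - b) (hp : p = 2 * n / ((n : ℝ) - 2 * (1 + a - b))) (hp2 : 2 < p)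
    (hlam : 2 * lam = n - 2 - 2 * a) (hlam0 : 0 < lam) (hκ : 2 * κ = lam * (p - 2)) (hm : 0 < m)
    {x : EuclideanSpace ℝ (Fin n)} {t : ℝ} (hx : ‖x‖ = exp t) :
    bubbleMu n a b (m ^ (1 / (2 * κ))) x = (2 * lam ^ 2 * p * m) ^ (1 / (p - 2)) *
      (exp (-lam * t) * bubbleProfile κ m t ^ (-(2 / (p - 2)))) := by
  have hp0 : p - 2 ≠ 0 := by linarith
  have hκ0 : 0 < κ := by nlinarith [mul_pos hlam0 (sub_pos.2 hp2)]
  have hμ : 0 < m ^ (1 / (2 * κ)) := Real.rpow_pos_of_pos hm _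
  have hb := bubbleProfile_pos (κ := κ) hm t
  rw [bubbleMu, bubble_eq hN hs hp hlam hκ, norm_smul, norm_inv, Real.norm_of_nonneg hμ.le, hx,
    ← hlam]
  have e1 : 1 + ((m ^ (1 / (2 * κ)))⁻¹ * exp t) ^ (2 * κ)
      = exp (κ * t) * m⁻¹ * bubbleProfile κ m t := by
    rw [Real.mul_rpow (inv_pos.2 hμ).le (exp_pos t).le, Real.inv_rpow hμ.le, ← Real.rpow_mul hm.le,
      one_div_mul_cancel (by positivity), Real.rpow_one, ← Real.exp_mul, bubbleProfile]
    have h1 : exp (κ * t) * exp (-κ * t) = 1 := by rw [← exp_add]; simp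
    have h2 : exp (t * (2 * κ)) = exp (κ * t) * exp (κ * t) := by
      rw [← exp_add]; congr 1; ring
    rw [h2]
    rw [neg_mul] at h1 ⊢
    field_simp
    linear_combination (-m) * h1
  have e2 : κ * t * (-(2 / (p - 2))) = -lam * t := by
    have : κ = lam * (p - 2) / 2 := by linarith
    rw [this]
    field_simp
  rw [e1, Real.mul_rpow (by positivity) hb.le, Real.mul_rpow (exp_pos _).le (by positivity),
    ← Real.exp_mul, e2, Real.inv_rpow hm.le, Real.rpow_neg hm.le, inv_inv, ← Real.rpow_mul hm.le,
    Real.mul_rpow (by positivity) hm.le]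
  have e3 : m ^ (1 / (2 * κ) * -(2 * lam / 2)) * m ^ (2 / (p - 2)) = m ^ (1 / (p - 2)) := by
    rw [← Real.rpow_add hm, hκ]
    congr 1
    field_simp
    ring
  linear_combination ((2 * lam ^ 2 * p) ^ (1 / (p - 2)) * exp (-lam * t)
    * bubbleProfile κ m t ^ (-(2 / (p - 2)))) * e3

/-- Dividing the amplitudes by `M ^ (1 / (p - 2))` normalizes the algebraic relation. -/
lemma coeff_relation_div {p ν α β C C₂ M : ℝ} (hp : 2 < p) (hαβ : α + β = p) (hC : 0 < C)
    (hC₂ : 0 < C₂) (hM : 0 < M)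
    (h : C ^ (p - 2) + ν * α * C ^ (α - 2) * C₂ ^ β = M) :
    (C / M ^ (1 / (p - 2))) ^ (p - 2)
      + ν * α * (C / M ^ (1 / (p - 2))) ^ (α - 2) * (C₂ / M ^ (1 / (p - 2))) ^ β = 1 := by
  have hD : 0 < M ^ (1 / (p - 2)) := Real.rpow_pos_of_pos hM _
  have hDp : (M ^ (1 / (p - 2))) ^ (p - 2) = M := by
    rw [← Real.rpow_mul hM.le, one_div_mul_cancel (by linarith), Real.rpow_one]
  have hDs : (M ^ (1 / (p - 2))) ^ (α - 2) * (M ^ (1 / (p - 2))) ^ β = M := by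
    rw [← Real.rpow_add hD, show α - 2 + β = p - 2 by linarith, hDp]
  have hα := Real.rpow_pos_of_pos hD (α - 2)
  have hβ := Real.rpow_pos_of_pos hD β
  rw [Real.div_rpow hC.le hD.le, Real.div_rpow hC.le hD.le, Real.div_rpow hC₂.le hD.le, hDp]
  calc _ = C ^ (p - 2) / M + ν * α * C ^ (α - 2) * C₂ ^ β
        / ((M ^ (1 / (p - 2))) ^ (α - 2) * (M ^ (1 / (p - 2))) ^ β) := by
        field_simp
    _ = 1 := by rw [hDs, ← add_div, h, div_self hM.ne']

theorem stmt {n : ℕ} (hn : 3 ≤ n) (a b p ν α β : ℝ)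
    (ha0 : 0 ≤ a) (ha : a < ((n:ℝ)-2)/2) (hb0 : 0 < b) (hab : a ≤ b) (hba : b < a + 1)
    (hp : p = 2*(n:ℝ)/((n:ℝ)-2+2*(b-a))) (hν : 0 < ν) (hα : 1 < α) (hβ : 1 < β)
    (hαβ : α + β = p)
    (u v : EuclideanSpace ℝ (Fin n) → ℝ)
    (hu : ContDiffOn ℝ 2 u {0}ᶜ) (hv : ContDiffOn ℝ 2 v {0}ᶜ)
    (hupos : ∀ x : EuclideanSpace ℝ (Fin n), x ≠ 0 → 0 < u x)
    (hvpos : ∀ x : EuclideanSpace ℝ (Fin n), x ≠ 0 → 0 < v x)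
    (hueq : ∀ x : EuclideanSpace ℝ (Fin n), x ≠ 0 →
      -(wdiv a u x) = ‖x‖ ^ (-(b*p)) * (u x ^ (p-1) + ν*α * u x ^ (α-1) * v x ^ β))
    (hveq : ∀ x : EuclideanSpace ℝ (Fin n), x ≠ 0 →
      -(wdiv a v x) = ‖x‖ ^ (-(b*p)) * (v x ^ (p-1) + ν*β * u x ^ α * v x ^ (β-1)))
    (hEu : finiteEnergy a u) (hEv : finiteEnergy a v) :
    ∃ μ₀ c₁ c₂ : ℝ, 0 < μ₀ ∧ 0 < c₁ ∧ 0 < c₂ ∧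
      (∀ x : EuclideanSpace ℝ (Fin n), x ≠ 0 →
        u x = c₁ * bubbleMu n a b μ₀ x ∧ v x = c₂ * bubbleMu n a b μ₀ x) ∧
      c₁ ^ (p-2) + ν*α * c₁ ^ (α-2) * c₂ ^ β = 1 ∧
      c₂ ^ (p-2) + ν*β * c₁ ^ α * c₂ ^ (β-2) = 1 := by
  have hn3 : (3 : ℝ) ≤ n := by exact_mod_cast hn
  have hp2 : 2 < p := by linarith
  have hN : 0 < (n : ℝ) - 2 * (1 + a - b) := by linarith
  have hs : 0 < 1 + a - b := by linarith
  have hpN : p = 2 * n / ((n : ℝ) - 2 * (1 + a - b)) := by rw [hp]; congr 1; ring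
  have hpn : p * ((n : ℝ) - 2 * (1 + a - b)) = 2 * n := by rw [hpN]; field_simp
  obtain ⟨lam, hlam⟩ : ∃ lam : ℝ, 2 * lam = n - 2 - 2 * a := ⟨(n - 2 - 2 * a) / 2, by ring⟩
  obtain ⟨κ, hκ⟩ : ∃ κ : ℝ, 2 * κ = lam * (p - 2) := ⟨lam * (p - 2) / 2, by ring⟩
  have hlam0 : 0 < lam := by linarith
  have hlamp : lam * (p - 2) = 2 + 2 * a - b * p := by nlinarith
  have hveq' : ∀ x : EuclideanSpace ℝ (Fin n), x ≠ 0 →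
      -(wdiv a v x) = ‖x‖ ^ (-(b * p)) * coupling p ν β α (v x) (u x) := fun x hx => by
    rw [hveq x hx, coupling]; ring
  have hU := isSingularSolution_of_wdiv hαβ hu hupos hvpos hueq
  have hV := isSingularSolution_of_wdiv (by linarith) hv hvpos hupos hveq'
  have hγ : 0 ≤ a * ((n : ℝ) - 2 - a) := mul_nonneg ha0 (by linarith)
  have hσ : 0 ≤ (b - a) * p := mul_nonneg (by linarith) (by linarith)
  have hγσ : 0 < a * ((n : ℝ) - 2 - a) ∨ 0 < (b - a) * p := by
    rcases ha0.eq_or_lt with h | h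
    · exact Or.inr (mul_pos (by linarith) (by linarith))
    · exact Or.inl (mul_pos h (by linarith))
  have hσp : (n : ℝ) + 2 - (n - 2) * (p - 1) = 2 * ((b - a) * p) := by linarith
  have descend : ∀ f : EuclideanSpace ℝ (Fin n) → ℝ,
      (∀ x y : EuclideanSpace ℝ (Fin n), ‖x‖ = ‖y‖ → ‖x‖ ^ (-a) * f x = ‖y‖ ^ (-a) * f y) →
      ∀ x y, x ≠ 0 → ‖x‖ = ‖y‖ → f x = f y := fun f hf x y hx hxy => by
    have h := hf x y hxy
    rw [← hxy] at h
    exact mul_left_cancel₀ (Real.rpow_pos_of_pos (norm_pos_iff.2 hx) _).ne' h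
  have hur := descend u fun x y hxy =>
    IsSingularSolution.radial hn hU hV hγ hσ hγσ hν hα hβ hαβ hσp hxy
  have hvr := descend v fun x y hxy =>
    IsSingularSolution.radial hn hV hU hγ hσ hγσ hν hβ hα (by linarith) hσp hxy
  obtain ⟨e, he⟩ : ∃ e : EuclideanSpace ℝ (Fin n), ‖e‖ = 1 :=
    ⟨EuclideanSpace.single ⟨0, by omega⟩ 1, by simp⟩
  have hw := fun t => hasD2_emden he hu hur hαβ hupos hvpos hlam hlamp hueq t
  have hz := fun t => hasD2_emden he hv hvr (by linarith) hvpos hupos hlam hlamp hveq' t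
  have hne : ∀ t, exp t • e ≠ 0 := fun t => by
    rw [← norm_ne_zero_iff, norm_smul, he]; simp
  have hpair : IsEmdenPair lam p ν α β (emden lam e u) (emden lam e v)
      (deriv (emden lam e u)) (deriv (emden lam e v)) :=
    { pos_left := fun t => mul_pos (exp_pos _) (hupos _ (hne t))
      pos_right := fun t => mul_pos (exp_pos _) (hvpos _ (hne t))
      hasDerivAt_left := fun t => (hw t).hasDerivAt.differentiableAt.hasDerivAt
      hasDerivAt_right := fun t => (hz t).hasDerivAt.differentiableAt.hasDerivAt
      hasDerivAt_left' := fun t => (hw t).hasDerivAt_deriv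
      hasDerivAt_right' := fun t => (hz t).hasDerivAt_deriv
      integrable_left := integrable_emden hn he hu hur hlam (fun t => (hw t).hasDerivAt.deriv) hEu
      integrable_right := integrable_emden hn he hv hvr hlam (fun t => (hz t).hasDerivAt.deriv) hEv }
  obtain ⟨m, C, C₂, hm, hC, hC₂, hwC, hzC, hrel, hrel'⟩ :=
    hpair.exists_bubble hlam0 hp2 hν hα hβ hαβ hκ
  have hM : 0 < 2 * lam ^ 2 * p * m := by positivity
  have hD : 0 < (2 * lam ^ 2 * p * m) ^ (1 / (p - 2)) := Real.rpow_pos_of_pos hM _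
  have recover : ∀ (f : EuclideanSpace ℝ (Fin n) → ℝ) (c : ℝ),
      (∀ x y, x ≠ 0 → ‖x‖ = ‖y‖ → f x = f y) →
      (∀ t, emden lam e f t = c * bubbleProfile κ m t ^ (-(2 / (p - 2)))) →
      ∀ x, x ≠ 0 → f x = c / (2 * lam ^ 2 * p * m) ^ (1 / (p - 2))
        * bubbleMu n a b (m ^ (1 / (2 * κ))) x := by
    intro f c hf hfc x hx
    have hxt : ‖x‖ = exp (log ‖x‖) := (Real.exp_log (norm_pos_iff.2 hx)).symm
    rw [bubbleMu_eq hN hs hpN hp2 hlam hlam0 hκ hm hxt]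
    have h1 := hfc (log ‖x‖)
    rw [emden, hf (exp (log ‖x‖) • e) x (hne _) (by rw [norm_smul, he, ← hxt]; simp)] at h1
    have h2 : exp (-lam * log ‖x‖) * exp (lam * log ‖x‖) = 1 := by rw [← exp_add]; simp
    rw [div_mul_eq_mul_div, eq_div_iff hD.ne']
    linear_combination ((2 * lam ^ 2 * p * m) ^ (1 / (p - 2))) * (exp (-lam * log ‖x‖) * h1 - f x * h2)
  refine ⟨m ^ (1 / (2 * κ)), C / (2 * lam ^ 2 * p * m) ^ (1 / (p - 2)),
    C₂ / (2 * lam ^ 2 * p * m) ^ (1 / (p - 2)), Real.rpow_pos_of_pos hm _, div_pos hC hD,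
    div_pos hC₂ hD, fun x hx => ⟨recover u C hur hwC x hx, recover v C₂ hvr hzC x hx⟩,
    coeff_relation_div hp2 hαβ hC hC₂ hM hrel, ?_⟩
  have h := coeff_relation_div (ν := ν) hp2 (by linarith : β + α = p) hC₂ hC hM
    (by rw [← hrel']; ring)
  linear_combination h
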